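/- arXiv:1901.06668 — 2 statements merged into one kernel-verified Lean document; each statement's English description precedes it below -/
import Mathlib

section
/- Let (R, m) be a Noetherian complete local ring and I an ideal of R. If cd(I, R) = t and the R-module H^t_I(R) is Artinian and I-cofinite, then Att_R H^t_I(R) = { p ∈ mAss_R R : dim R/p = t and Rad(I + p) = m }. -/
universe u

open CategoryTheory

/-- An `R`-module `L` is `I`-cofinite if `Supp L ⊆ V(I)` and `Ext^i_R(R/I, L)` is a finitely
generated `R`-module for all `i ≥ 0`. -/
def IsCofinite {R : Type u} [CommRing R] (I : Ideal R) (L : ModuleCat.{u} R) : Prop :=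
  Module.support R L ⊆ PrimeSpectrum.zeroLocus (I : Set R) ∧
    ∀ i : ℕ, Module.Finite R
      (((Ext R (ModuleCat.{u} R) i).obj (Opposite.op (ModuleCat.of R (R ⧸ I)))).obj L)

/-- The cohomological dimension `cd(I, M)`: the supremum (in `WithBot ℕ∞`, so that the
supremum of the empty set is `⊥ = -∞`) of the set of indices `i` with `H^i_I(M) ≠ 0`. -/
noncomputable def cohomologicalDim {R : Type u} [CommRing R] (I : Ideal R)
    (M : ModuleCat.{u} R) : WithBot ℕ∞ :=
  sSup ((fun i : ℕ => ((i : ℕ∞) : WithBot ℕ∞)) ''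
    {i : ℕ | Nontrivial ((localCohomology I i).obj M)})

/-- `mAss_R R`: the set of minimal elements of `Ass_R R` with respect to inclusion. -/
def minimalAssociatedPrimes (R : Type u) [CommRing R] : Set (Ideal R) :=
  {p ∈ associatedPrimes R R | ∀ q ∈ associatedPrimes R R, q ≤ p → q = p}

/-- The attached primes of a module, following Macdonald: the primes of the form
`Ann_R (M/N)` for some submodule `N ⊆ M`.  For an Artinian module `M` this set coincides with
the set of primes occurring in a minimal secondary representation of `M`. -/
def attachedPrimes (R : Type u) [CommRing R] (M : Type u) [AddCommGroup M] [Module R M] :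
    Set (Ideal R) :=
  {p | p.IsPrime ∧ ∃ N : Submodule R M, p = Module.annihilator R (M ⧸ N)}

namespace LCAux
noncomputable section Compare
open Limits Opposite

variable {R : Type u} [CommRing R]

/-- the complex computing the old Ext -/
abbrev KC {X : ModuleCat.{u} R} (P : ProjectiveResolution X) (Y : ModuleCat.{u} R) :
    ChainComplex (ModuleCat.{u} R)ᵒᵖ ℕ :=
  (((linearYoneda R (ModuleCat.{u} R)).obj Y).rightOp.mapHomologicalComplex _).obj P.complex

variable {X : ModuleCat.{u} R} (P : ProjectiveResolution X) (Y : ModuleCat.{u} R) (n : ℕ)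

abbrev ZC : ModuleCat.{u} R := unop ((KC P Y).opcycles n)
abbrev HC : ModuleCat.{u} R := unop ((KC P Y).homology n)

def jmap : ZC P Y n ⟶ ModuleCat.of R (P.complex.X n ⟶ Y) :=
  ((KC P Y).pOpcycles n).unop

def pmap : ZC P Y n ⟶ HC P Y n :=
  ((KC P Y).homologyι n).unop

lemma jmap_inj : Function.Injective (jmap P Y n).hom := by
  have : Mono (jmap P Y n) := by
    unfold jmap
    exact @unop_mono_of_epi _ _ _ _ ((KC P Y).pOpcycles n) inferInstance
  exact (ModuleCat.mono_iff_injective _).mp this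

lemma pmap_surj : Function.Surjective (pmap P Y n).hom := by
  have : Epi (pmap P Y n) := by unfold pmap; infer_instance
  exact (ModuleCat.epi_iff_surjective _).mp this

lemma jmap_range (f : P.complex.X n ⟶ Y) :
    (∃ z, (jmap P Y n).hom z = f) ↔ P.complex.d (n+1) n ≫ f = 0 := by
  have h := ShortComplex.exact_of_g_is_cokernel
    (ShortComplex.mk ((KC P Y).d (n+1) n) ((KC P Y).pOpcycles n) ((KC P Y).d_pOpcycles _ _))
    ((KC P Y).opcyclesIsCokernel (n+1) n (by simp))
  have h2 := (ShortComplex.moduleCat_exact_iff _).1 h.unop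
  have h3 := (ShortComplex.unop (ShortComplex.mk ((KC P Y).d (n+1) n) ((KC P Y).pOpcycles n)
    ((KC P Y).d_pOpcycles _ _))).zero
  constructor
  · rintro ⟨z, rfl⟩
    exact congrArg (fun (t : _ ⟶ _) => (ModuleCat.Hom.hom t) z) h3
  · intro hf
    exact h2 f hf

lemma pmap_ker (z : ZC P Y n) :
    (pmap P Y n).hom z = 0 ↔
      ∃ g : P.complex.X ((ComplexShape.down ℕ).next n) ⟶ Y, P.complex.d n _ ≫ g = (jmap P Y n).hom z := by
  have h := ShortComplex.exact_of_f_is_kernel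
    (ShortComplex.mk ((KC P Y).homologyι n) ((KC P Y).fromOpcycles n _) (by simp))
    ((KC P Y).homologyIsKernel n _ rfl)
  have h2 := (ShortComplex.moduleCat_exact_iff _).1 h.unop
  have h3 := (ShortComplex.unop (ShortComplex.mk ((KC P Y).homologyι n)
    ((KC P Y).fromOpcycles n ((ComplexShape.down ℕ).next n)) (by simp))).zero
  have h4 : ((KC P Y).fromOpcycles n ((ComplexShape.down ℕ).next n)).unop ≫ jmap P Y n =
      ((KC P Y).d n ((ComplexShape.down ℕ).next n)).unop := by
    exact congrArg Quiver.Hom.unop ((KC P Y).p_fromOpcycles n ((ComplexShape.down ℕ).next n))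
  have h5 : ∀ g : P.complex.X ((ComplexShape.down ℕ).next n) ⟶ Y, (jmap P Y n).hom
    (((KC P Y).fromOpcycles n ((ComplexShape.down ℕ).next n)).unop.hom g) = P.complex.d n _ ≫ g :=
     fun g => congrArg (fun (t : _ ⟶ _) => (ModuleCat.Hom.hom t) g) h4
  constructor
  · intro hz
    obtain ⟨g, hg⟩ := h2 z hz
    refine ⟨g, ?_⟩
    exact (h5 g).symm.trans (congrArg (jmap P Y n).hom hg)
  · rintro ⟨g, hg⟩
    have := jmap_inj P Y n ((h5 g).trans hg)
    rw [← this]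
    exact congrArg (fun (t : _ ⟶ _) => (ModuleCat.Hom.hom t) g) h3

/-- `z ↦ extMk` -/
def emap : ZC P Y n →ₗ[R] Abelian.Ext.{u} X Y n where
  toFun z := P.extMk ((jmap P Y n).hom z) (n+1) rfl ((jmap_range P Y n _).1 ⟨z, rfl⟩)
  map_add' a b := by
    rw [P.add_extMk]
    congr 1
    exact map_add _ _ _
  map_smul' r a := by
    rw [RingHom.id_apply, Abelian.Ext.smul_eq_comp_mk₀, P.extMk_comp_mk₀]
    congr 1
    have h : ∀ f : P.complex.X n ⟶ Y, r • f = f ≫ (r • 𝟙 Y) := fun f => by simp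
    exact (map_smul _ _ _).trans (h _)

lemma emap_surj : Function.Surjective (emap P Y n) := by
  intro e
  obtain ⟨f, hf, rfl⟩ := P.extMk_surjective e (n+1) rfl
  obtain ⟨z, rfl⟩ := (jmap_range P Y n f).2 hf
  exact ⟨z, rfl⟩

lemma extMk_zero_iff (f : P.complex.X n ⟶ Y) (hf : P.complex.d (n+1) n ≫ f = 0) :
    P.extMk f (n+1) rfl hf = 0 ↔
      ∃ g : P.complex.X ((ComplexShape.down ℕ).next n) ⟶ Y, P.complex.d n _ ≫ g = f := by
  obtain _ | n := n
  · have : P.complex.d 0 ((ComplexShape.down ℕ).next 0) = 0 := by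
      apply P.complex.shape
      simp
    simp only [this, Limits.zero_comp]
    constructor
    · intro h
      refine ⟨0, ?_⟩
      simp only [← P.extEquivCohomologyClass.apply_eq_iff_eq,
        ProjectiveResolution.extEquivCohomologyClass_extMk, ProjectiveResolution.extEquivCohomologyClass_zero,
        CochainComplex.HomComplex.CohomologyClass.mk_eq_zero_iff] at h
      rw [CochainComplex.HomComplex.Cocycle.toSingleMk_mem_coboundaries_iff _ _ _ _ _ 1 (by simp)] at h
      obtain ⟨g, hg⟩ := h
      have hz : IsZero (P.cochainComplex.X 1) := by
        apply CochainComplex.isZero_of_isStrictlyLE _ 0 1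
      rw [hz.eq_of_src g 0, Limits.comp_zero] at hg
      rw [← cancel_epi (P.cochainComplexXIso (-(0:ℕ)) 0 rfl).hom, Limits.comp_zero]
      exact hg
    · rintro ⟨_, h⟩
      subst h
      simp
  · have : (ComplexShape.down ℕ).next (n+1) = n := ComplexShape.next_eq' _ (by simp)
    rw [this]
    exact P.extMk_eq_zero_iff f _ rfl hf n rfl

lemma ker_eq : LinearMap.ker (emap P Y n) = LinearMap.ker (pmap P Y n).hom := by
  ext z
  rw [LinearMap.mem_ker, LinearMap.mem_ker, pmap_ker]
  exact extMk_zero_iff P Y n _ ((jmap_range P Y n _).1 ⟨z, rfl⟩)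

/-- homology iso -/
def hequiv : HC P Y n ≃ₗ[R] Abelian.Ext.{u} X Y n :=
  ((pmap P Y n).hom.quotKerEquivOfSurjective (pmap_surj P Y n)).symm ≪≫ₗ
    Submodule.quotEquivOfEq _ _ (ker_eq P Y n).symm ≪≫ₗ
    (emap P Y n).quotKerEquivOfSurjective (emap_surj P Y n)

lemma hequiv_pmap (z : ZC P Y n) : hequiv P Y n ((pmap P Y n).hom z) = emap P Y n z := by
  unfold hequiv
  simp only [LinearEquiv.trans_apply]
  have : ((pmap P Y n).hom.quotKerEquivOfSurjective (pmap_surj P Y n)).symm ((pmap P Y n).hom z)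
    = Submodule.Quotient.mk z := by
    rw [LinearEquiv.symm_apply_eq]; rfl
  rw [this]
  rfl

/-- the comparison -/
def theta (X Y : ModuleCat.{u} R) (n : ℕ) :
    ((Ext R (ModuleCat.{u} R) n).obj (op X)).obj Y ≃ₗ[R] Abelian.Ext.{u} X Y n :=
  ((projectiveResolution X).isoLeftDerivedObj
    ((linearYoneda R (ModuleCat.{u} R)).obj Y).rightOp n).unop.symm.toLinearEquiv ≪≫ₗ
    hequiv (projectiveResolution X) Y n

lemma theta_nat {X X' : ModuleCat.{u} R} (g : X' ⟶ X) (Y : ModuleCat.{u} R) (n : ℕ)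
    (x : ((Ext R (ModuleCat.{u} R) n).obj (op X)).obj Y) :
    theta X' Y n ((((Ext R (ModuleCat.{u} R) n).map g.op).app Y).hom x) =
      (Abelian.Ext.mk₀ g).comp (theta X Y n x) (zero_add n) := by
  let P := projectiveResolution X
  let P' := projectiveResolution X'
  let F := ((linearYoneda R (ModuleCat.{u} R)).obj Y).rightOp
  let φ : P'.complex ⟶ P.complex := ProjectiveResolution.lift g P' P
  have hφ : φ.f 0 ≫ P.π.f 0 = P'.π.f 0 ≫ g := ProjectiveResolution.lift_commutes_zero g P' P
  have h1 := congrArg Quiver.Hom.unop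
    (ProjectiveResolution.isoLeftDerivedObj_inv_naturality g P' P φ hφ F n)
  rw [unop_comp, unop_comp] at h1
  have h2 := congrArg (fun (t : _ ⟶ _) => (ModuleCat.Hom.hom t) x) h1
  have h3 : theta X' Y n ((((Ext R (ModuleCat.{u} R) n).map g.op).app Y).hom x) =
      hequiv P' Y n ((HomologicalComplex.homologyMap ((F.mapHomologicalComplex _).map φ) n).unop.hom
        ((P.isoLeftDerivedObj F n).inv.unop.hom x)) := congrArg (hequiv P' Y n) h2
  have h4 : theta X Y n x = hequiv P Y n ((P.isoLeftDerivedObj F n).inv.unop.hom x) := rfl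
  rw [h3, h4]
  obtain ⟨z, hz⟩ := pmap_surj P Y n ((P.isoLeftDerivedObj F n).inv.unop.hom x)
  rw [← hz, hequiv_pmap]
  have h5 : (HomologicalComplex.homologyMap ((F.mapHomologicalComplex _).map φ) n).unop.hom
      ((pmap P Y n).hom z) = (pmap P' Y n).hom
        ((HomologicalComplex.opcyclesMap ((F.mapHomologicalComplex _).map φ) n).unop.hom z) := by
    have := congrArg Quiver.Hom.unop
      (HomologicalComplex.homologyι_naturality ((F.mapHomologicalComplex _).map φ) n)
    rw [unop_comp, unop_comp] at this
    exact congrArg (fun (t : _ ⟶ _) => (ModuleCat.Hom.hom t) z) this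
  have h6 : (jmap P' Y n).hom
      ((HomologicalComplex.opcyclesMap ((F.mapHomologicalComplex _).map φ) n).unop.hom z) =
      φ.f n ≫ (jmap P Y n).hom z := by
    have := congrArg Quiver.Hom.unop
      (HomologicalComplex.p_opcyclesMap ((F.mapHomologicalComplex _).map φ) n)
    rw [unop_comp, unop_comp] at this
    exact congrArg (fun (t : _ ⟶ _) => (ModuleCat.Hom.hom t) z) this
  rw [h5, hequiv_pmap]
  have h7 := ProjectiveResolution.mk₀_comp_extMk ((jmap P Y n).hom z) (n+1) rfl
    ((jmap_range P Y n _).1 ⟨z, rfl⟩) (R' := P') (g := g) ⟨φ, by simpa using hφ⟩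
  refine Eq.trans ?_ h7.symm
  change P'.extMk ((jmap P' Y n).hom _) (n+1) rfl ((jmap_range P' Y n _).1 ⟨_, rfl⟩) = _
  congr 1

end Compare
end LCAux

namespace LCAux
noncomputable section Model
open Limits Opposite Abelian

variable {R : Type u} [CommRing R] (I : Ideal R)

abbrev QI (n : ℕ) : ModuleCat.{u} R := ModuleCat.of R (R ⧸ I ^ n)

def qmap {m n : ℕ} (h : m ≤ n) : QI I n ⟶ QI I m :=
  ModuleCat.ofHom (Submodule.mapQ (I ^ n) (I ^ m) LinearMap.id (Ideal.pow_le_pow_right h))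

lemma qmap_refl (n : ℕ) : qmap I (le_refl n) = 𝟙 _ := by
  ext
  simp [qmap]

lemma qmap_comp {l m n : ℕ} (h : l ≤ m) (h' : m ≤ n) :
    qmap I h' ≫ qmap I h = qmap I (h.trans h') := by
  ext
  simp [qmap]

abbrev G (i : ℕ) (M : Type u) [AddCommGroup M] [Module R M] (n : ℕ) : Type u :=
  Ext.{u} (QI I n) (ModuleCat.of R M) i

def tr (i : ℕ) (M : Type u) [AddCommGroup M] [Module R M] (m n : ℕ) (h : m ≤ n) :
    G I i M m →ₗ[R] G I i M n :=
  Ext.precompOfLinear (Ext.mk₀ (qmap I h)) R (ModuleCat.of R M) (zero_add i)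

lemma tr_apply (i : ℕ) (M : Type u) [AddCommGroup M] [Module R M] (m n : ℕ) (h : m ≤ n)
    (x : G I i M m) : tr I i M m n h x = (Ext.mk₀ (qmap I h)).comp x (zero_add i) := rfl

instance (i : ℕ) (M : Type u) [AddCommGroup M] [Module R M] :
    DirectedSystem (G I i M) (fun m n h => tr I i M m n h) where
  map_self n x := by
    simp [tr_apply, qmap_refl]
  map_map _ _ _ h h' x := by
    rw [tr_apply, tr_apply, tr_apply, ← qmap_comp I h h', ← Ext.mk₀_comp_mk₀_assoc]

/-- local cohomology, as a direct limit -/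
def LC (i : ℕ) (M : Type u) [AddCommGroup M] [Module R M] : Type u :=
  Module.DirectLimit (G I i M) (tr I i M)

section
variable (i : ℕ) (M : Type u) [AddCommGroup M] [Module R M]
instance : AddCommGroup (LC I i M) := inferInstanceAs (AddCommGroup (Module.DirectLimit _ _))
instance : Module R (LC I i M) := inferInstanceAs (Module R (Module.DirectLimit _ _))

def lof (n : ℕ) : G I i M n →ₗ[R] LC I i M :=
  Module.DirectLimit.of R ℕ (G I i M) (tr I i M) n

variable {i M}
lemma lof_tr {m n : ℕ} (h : m ≤ n) (x : G I i M m) : lof I i M n (tr I i M m n h x) = lof I i M m x :=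
  Module.DirectLimit.of_f

lemma lof_exists (z : LC I i M) : ∃ n x, lof I i M n x = z :=
  Module.DirectLimit.exists_of z

lemma lof_zero {n : ℕ} {x : G I i M n} (h : lof I i M n x = 0) :
    ∃ m, ∃ h : n ≤ m, tr I i M n m h x = 0 := by
  obtain ⟨m, h, hh⟩ := Module.DirectLimit.of.zero_exact h
  exact ⟨m, h, hh⟩
end

section
variable {M N P : Type u} [AddCommGroup M] [Module R M] [AddCommGroup N] [Module R N]
  [AddCommGroup P] [Module R P]

def gmap {i j k : ℕ} (e : Ext.{u} (ModuleCat.of R M) (ModuleCat.of R N) k) (h : i + k = j) (n : ℕ) :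
    G I i M n →ₗ[R] G I j N n := Ext.postcompOfLinear e R (QI I n) h

lemma gmap_apply {i j k : ℕ} (e : Ext.{u} (ModuleCat.of R M) (ModuleCat.of R N) k) (h : i + k = j)
    (n : ℕ) (x : G I i M n) : gmap I e h n x = x.comp e h := rfl

lemma gmap_tr {i j k : ℕ} (e : Ext.{u} (ModuleCat.of R M) (ModuleCat.of R N) k) (h : i + k = j)
    (m n : ℕ) (hmn : m ≤ n) (x : G I i M m) :
    gmap I e h n (tr I i M m n hmn x) = tr I j N m n hmn (gmap I e h m x) := by
  simp only [gmap_apply, tr_apply]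
  rw [Ext.comp_assoc _ _ _ (zero_add i) h (by omega)]

def lmap {i j k : ℕ} (e : Ext.{u} (ModuleCat.of R M) (ModuleCat.of R N) k) (h : i + k = j) :
    LC I i M →ₗ[R] LC I j N :=
  Module.DirectLimit.map (gmap I e h) (by
    intro m n hmn; ext x; exact gmap_tr I e h m n hmn x)

lemma lmap_lof {i j k : ℕ} (e : Ext.{u} (ModuleCat.of R M) (ModuleCat.of R N) k) (h : i + k = j)
    {n : ℕ} (x : G I i M n) : lmap I e h (lof I i M n x) = lof I j N n (x.comp e h) :=
  Module.DirectLimit.map_apply_of _ _ _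

def LC.map (i : ℕ) (f : M →ₗ[R] N) : LC I i M →ₗ[R] LC I i N :=
  lmap I (Ext.mk₀ (ModuleCat.ofHom f)) (add_zero i)

lemma LC.map_id (i : ℕ) (z : LC I i M) : LC.map I i (LinearMap.id : M →ₗ[R] M) z = z := by
  obtain ⟨n, x, rfl⟩ := lof_exists I z
  rw [LC.map, lmap_lof, ModuleCat.ofHom_id, Ext.comp_mk₀_id]

lemma LC.map_comp (i : ℕ) (f : M →ₗ[R] N) (g : N →ₗ[R] P) (z : LC I i M) :
    LC.map I i (g ∘ₗ f) z = LC.map I i g (LC.map I i f z) := by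
  obtain ⟨n, x, rfl⟩ := lof_exists I z
  rw [LC.map, lmap_lof, LC.map, LC.map, lmap_lof, lmap_lof, ModuleCat.ofHom_comp]
  rw [Ext.comp_assoc_of_third_deg_zero, Ext.mk₀_comp_mk₀]

lemma LC.map_smul (i : ℕ) (r : R) (f : M →ₗ[R] N) (z : LC I i M) :
    LC.map I i (r • f) z = r • LC.map I i f z := by
  obtain ⟨n, x, rfl⟩ := lof_exists I z
  rw [LC.map, lmap_lof, LC.map, lmap_lof, ← LinearMap.map_smul]
  congr 1
  rw [← Ext.comp_smul, ← Ext.mk₀_smul]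
  rfl

lemma LC.map_zero (i : ℕ) (z : LC I i M) :
    LC.map I i (0 : M →ₗ[R] N) z = 0 := by
  have := LC.map_smul I i (0 : R) (0 : M →ₗ[R] N) z
  simpa using this

lemma LC.exact (f : M →ₗ[R] N) (g : N →ₗ[R] P) (hf : Function.Injective f)
    (hg : Function.Surjective g) (hfg : Function.Exact f g) (i : ℕ) :
    ∃ δ : LC I i P →ₗ[R] LC I (i + 1) M, Function.Exact (LC.map I i f) (LC.map I i g) ∧
      Function.Exact (LC.map I i g) δ ∧ Function.Exact δ (LC.map I (i + 1) f) := by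
  let S : ShortComplex (ModuleCat.{u} R) := ShortComplex.mk (ModuleCat.ofHom f) (ModuleCat.ofHom g)
    (by ext x; exact hfg.apply_apply_eq_zero x)
  have hS : S.ShortExact :=
    { exact := (ShortComplex.ShortExact.moduleCat_exact_iff_function_exact S).2 hfg
      mono_f := (ModuleCat.mono_iff_injective _).2 hf
      epi_g := (ModuleCat.epi_iff_surjective _).2 hg }
  have hgf : ∀ x, g (f x) = 0 := hfg.apply_apply_eq_zero
  refine ⟨lmap I (N := M) (M := P) hS.extClass rfl, ?_, ?_, ?_⟩
  · intro z
    constructor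
    · intro hz
      obtain ⟨n, x, rfl⟩ := lof_exists I z
      rw [LC.map, lmap_lof] at hz
      obtain ⟨m, hm, hx⟩ := lof_zero I hz
      have h2 := gmap_tr I (Ext.mk₀ (ModuleCat.ofHom g)) (add_zero i) n m hm x
      rw [gmap_apply I _ _ n, hx] at h2
      obtain ⟨y, hy⟩ := Ext.covariant_sequence_exact₂ (QI I m) hS (tr I i N n m hm x) h2
      refine ⟨lof I i M m y, ?_⟩
      rw [LC.map, lmap_lof, ← lof_tr I hm x]
      exact congrArg _ hy
    · rintro ⟨w, rfl⟩
      rw [← LC.map_comp, hfg.linearMap_comp_eq_zero, LC.map_zero]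
  · intro z
    constructor
    · intro hz
      obtain ⟨n, x, rfl⟩ := lof_exists I z
      rw [lmap_lof] at hz
      obtain ⟨m, hm, hx⟩ := lof_zero I hz
      have h2 := gmap_tr I (M := P) (N := M) hS.extClass rfl n m hm x
      rw [gmap_apply I _ _ n, hx] at h2
      obtain ⟨y, hy⟩ := Ext.covariant_sequence_exact₃ (QI I m) hS (tr I i P n m hm x) rfl h2
      refine ⟨lof I i N m y, ?_⟩
      rw [LC.map, lmap_lof, ← lof_tr I hm x]
      exact congrArg _ hy
    · rintro ⟨w, rfl⟩
      obtain ⟨n, x, rfl⟩ := lof_exists I w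
      rw [LC.map, lmap_lof, lmap_lof]
      have : ((x.comp (Ext.mk₀ (ModuleCat.ofHom g)) (add_zero i)).comp hS.extClass rfl) = 0 := by
        rw [Ext.comp_assoc_of_second_deg_zero]
        have := hS.comp_extClass
        erw [this]
        simp
      erw [this]
      simp
  · intro z
    constructor
    · intro hz
      obtain ⟨n, x, rfl⟩ := lof_exists I z
      rw [LC.map, lmap_lof] at hz
      obtain ⟨m, hm, hx⟩ := lof_zero I hz
      have h2 := gmap_tr I (Ext.mk₀ (ModuleCat.ofHom f)) (add_zero (i+1)) n m hm x
      rw [gmap_apply I _ _ n, hx] at h2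
      obtain ⟨y, hy⟩ := Ext.covariant_sequence_exact₁ (QI I m) hS (tr I (i+1) M n m hm x) h2 rfl
      refine ⟨lof I i P m y, ?_⟩
      rw [lmap_lof, ← lof_tr I hm x]
      exact congrArg _ hy
    · rintro ⟨w, rfl⟩
      obtain ⟨n, x, rfl⟩ := lof_exists I w
      rw [LC.map, lmap_lof, lmap_lof]
      have : ((x.comp hS.extClass rfl).comp (Ext.mk₀ (ModuleCat.ofHom f)) (add_zero (i+1))) = 0 := by
        rw [Ext.comp_assoc_of_third_deg_zero]
        have := hS.extClass_comp
        erw [this]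
        simp
      erw [this]
      simp

lemma LC.torsion (i : ℕ) (z : LC I i M) : ∃ n : ℕ, ∀ r ∈ I ^ n, r • z = 0 := by
  obtain ⟨n, x, rfl⟩ := lof_exists I z
  refine ⟨n, fun r hr => ?_⟩
  rw [← LinearMap.map_smul]
  have h0 : r • (𝟙 (QI I n)) = 0 := by
    ext
    simp only [ModuleCat.hom_smul, ModuleCat.hom_id]
    change r • (Submodule.Quotient.mk (1 : R) : R ⧸ I ^ n) = 0
    rw [← Submodule.Quotient.mk_smul, Submodule.Quotient.mk_eq_zero]
    simpa using hr
  have : r • x = 0 := by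
    have h1 : (Ext.mk₀ (r • 𝟙 (QI I n))).comp x (zero_add i) = r • x := by
      rw [Ext.mk₀_smul, Ext.smul_comp, Ext.mk₀_id_comp]
    rw [← h1, h0]; simp
  rw [this, _root_.map_zero]

/-- comparison -/
lemma compare (i : ℕ) : Nonempty ((localCohomology I i).obj (ModuleCat.of R M) ≃ₗ[R] LC I i M) := by
  let D := localCohomology.diagram (localCohomology.idealPowersDiagram I) i
  let ev := (evaluation (ModuleCat.{u} R) (ModuleCat.{u} R)).obj (ModuleCat.of R M)
  let c := colimit.cocone D
  have hc : IsColimit (ev.mapCocone c) := isColimitOfPreserves ev (colimit.isColimit D)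
  let th := fun n => theta (QI I n) (ModuleCat.of R M) i
  let ι : ∀ n : ℕ, ((Ext R (ModuleCat.{u} R) i).obj (op (QI I n))).obj (ModuleCat.of R M) ⟶
    ev.obj (colimit D) := fun n => (ev.mapCocone c).ι.app (op (op n))
  have hι : ∀ m n (h : m ≤ n) x, (ι n).hom ((((Ext R (ModuleCat.{u} R) i).map (qmap I h).op).app
      (ModuleCat.of R M)).hom x) = (ι m).hom x := by
    intro m n h x
    have := (ev.mapCocone c).w (homOfLE h).op.op
    exact congrArg (fun (t : _ ⟶ _) => (ModuleCat.Hom.hom t) x) this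
  let Φ : LC I i M →ₗ[R] (ev.obj (colimit D)) :=
    Module.DirectLimit.lift R ℕ (G I i M) (tr I i M) (fun n => (ι n).hom ∘ₗ (th n).symm.toLinearMap)
      (by
        intro m n h x
        obtain ⟨y, rfl⟩ := (th m).surjective x
        simp only [LinearMap.comp_apply, LinearEquiv.coe_coe, LinearEquiv.symm_apply_apply]
        rw [← hι m n h y]
        congr 1
        rw [LinearEquiv.symm_apply_eq, tr_apply]
        exact (theta_nat (qmap I h) _ _ _).symm)
  have hΦ : ∀ n x, Φ (lof I i M n x) = (ι n).hom ((th n).symm x) := fun n x =>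
    Module.DirectLimit.lift_of _ _ _
  let s : Cocone (D ⋙ ev) :=
    { pt := ModuleCat.of R (LC I i M)
      ι := { app := fun n => ModuleCat.ofHom ((lof I i M n.unop.unop) ∘ₗ (th n.unop.unop).toLinearMap)
             naturality := by
              intro m n f
              ext x
              have h : m.unop.unop ≤ n.unop.unop := leOfHom f.unop.unop
              have h1 := theta_nat (qmap I h) (ModuleCat.of R M) i x
              have h2 := lof_tr I h (th m.unop.unop x)
              rw [tr_apply] at h2
              change lof I i M n.unop.unop _ = lof I i M m.unop.unop (th m.unop.unop x)
              rw [← h2]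
              exact congrArg (lof I i M n.unop.unop) h1 } }
  let Ψ := hc.desc s
  have hΨ : ∀ n x, Ψ.hom ((ι n).hom x) = lof I i M n (th n x) := by
    intro n x
    exact congrArg (fun (t : _ ⟶ _) => (ModuleCat.Hom.hom t) x) (hc.fac s (op (op n)))
  have e1 : Ψ ≫ ModuleCat.ofHom Φ = 𝟙 _ := by
    apply hc.hom_ext
    intro n
    ext x
    have := hΨ n.unop.unop x
    have h2 := congrArg Φ this
    exact h2.trans ((hΦ _ _).trans (congrArg (ι n.unop.unop).hom
      ((th n.unop.unop).symm_apply_apply x)))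
  refine ⟨LinearEquiv.ofLinearMap Ψ.hom Φ ?_ ?_⟩
  · ext z
    obtain ⟨n, x, rfl⟩ := lof_exists I z
    exact (congrArg Ψ.hom (hΦ n x)).trans ((hΨ _ _).trans (by simp))
  · exact congrArg ModuleCat.Hom.hom e1

end
end Model
end LCAux

namespace LCAux
noncomputable section Vanish
open Limits Opposite Abelian

variable {R : Type u} [CommRing R]

lemma sexact {M N P : Type u} [AddCommGroup M] [Module R M] [AddCommGroup N] [Module R N]
    [AddCommGroup P] [Module R P] (f : M →ₗ[R] N) (g : N →ₗ[R] P) (hf : Function.Injective f)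
    (hg : Function.Surjective g) (hfg : Function.Exact f g) :
    (ShortComplex.mk (ModuleCat.ofHom f) (ModuleCat.ofHom g)
      (by ext x; exact hfg.apply_apply_eq_zero x)).ShortExact :=
  { exact := (ShortComplex.ShortExact.moduleCat_exact_iff_function_exact _).2 hfg
    mono_f := (ModuleCat.mono_iff_injective _).2 hf
    epi_g := (ModuleCat.epi_iff_surjective _).2 hg }

lemma ext_shift {K F N M : Type u} [AddCommGroup K] [Module R K] [AddCommGroup F] [Module R F]
    [AddCommGroup N] [Module R N] [AddCommGroup M] [Module R M] [Module.Projective R F]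
    (f : K →ₗ[R] F) (g : F →ₗ[R] N) (hf : Function.Injective f)
    (hg : Function.Surjective g) (hfg : Function.Exact f g) (j : ℕ)
    (ξ : Ext.{u} (ModuleCat.of R N) (ModuleCat.of R M) (j + 1)) :
    ∃ η : Ext.{u} (ModuleCat.of R K) (ModuleCat.of R M) j,
      ∀ (K' F' N' : Type u) [AddCommGroup K'] [Module R K'] [AddCommGroup F'] [Module R F']
        [AddCommGroup N'] [Module R N'] (f' : K' →ₗ[R] F') (g' : F' →ₗ[R] N')
        (_ : Function.Injective f') (_ : Function.Surjective g') (_ : Function.Exact f' g')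
        (a : K' →ₗ[R] K) (b : F' →ₗ[R] F) (c : N' →ₗ[R] N) (_ : f ∘ₗ a = b ∘ₗ f')
        (_ : g ∘ₗ b = c ∘ₗ g'),
        (Ext.mk₀ (ModuleCat.ofHom a)).comp η (zero_add j) = 0 →
        (Ext.mk₀ (ModuleCat.ofHom c)).comp ξ (zero_add (j + 1)) = 0 := by
  have hS := sexact f g hf hg hfg
  have : Projective (ModuleCat.of R F) := (IsProjective.iff_projective (R := R) F).1 inferInstance
  obtain ⟨η, hη⟩ := Ext.contravariant_sequence_exact₃ hS (ModuleCat.of R M) ξ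
    (Ext.eq_zero_of_projective (P := ModuleCat.of R F) _) (add_comm 1 j)
  refine ⟨η, ?_⟩
  intro K' F' N' _ _ _ _ _ _ f' g' hf' hg' hfg' a b c hab hbc h0
  have hS' := sexact f' g' hf' hg' hfg'
  have := ShortComplex.ShortExact.extClass_naturality hS' hS
    { τ₁ := ModuleCat.ofHom a
      τ₂ := ModuleCat.ofHom b
      τ₃ := ModuleCat.ofHom c
      comm₁₂ := by
        simpa using congrArg ModuleCat.ofHom hab
      comm₂₃ := by
        simpa using congrArg ModuleCat.ofHom hbc }
  rw [← hη]
  have e1 := Ext.comp_assoc (Ext.mk₀ (ModuleCat.ofHom c)) hS.extClass η (zero_add 1) (add_comm 1 j)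
    (by omega : 0 + 1 + j = j + 1)
  refine e1.symm.trans ?_
  have e2 : (Ext.mk₀ (ModuleCat.ofHom c)).comp hS.extClass (zero_add 1) =
     hS'.extClass.comp (Ext.mk₀ (ModuleCat.ofHom a)) (add_zero 1) := this.symm
  have e3 := Ext.comp_assoc hS'.extClass (Ext.mk₀ (ModuleCat.ofHom a)) η (add_zero 1) (zero_add j)
    (by omega : 1 + 0 + j = j + 1)
  have e4 : hS'.extClass.comp ((Ext.mk₀ (ModuleCat.ofHom a)).comp η (zero_add j)) (add_comm 1 j) = 0 := by
    rw [h0]; simp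
  exact (congrArg (fun t => Ext.comp t η (add_comm 1 j)) e2).trans (e3.trans e4)

variable [IsNoetherianRing R] (I : Ideal R)

lemma ext_restrict {M : Type u} [AddCommGroup M] [Module R M] (c : ℕ)
    (hc : ∀ r ∈ I ^ c, ∀ x : M, r • x = 0) (j : ℕ) :
    ∀ (N : Type u) [AddCommGroup N] [Module R N] [Module.Finite R N]
      (ξ : Ext.{u} (ModuleCat.of R N) (ModuleCat.of R M) j),
      ∃ k : ℕ, ∀ (L : Type u) [AddCommGroup L] [Module R L] (a : L →ₗ[R] N),
        LinearMap.range a ≤ I ^ k • (⊤ : Submodule R N) →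
        (Ext.mk₀ (ModuleCat.ofHom a)).comp ξ (zero_add j) = 0 := by
  induction j with
  | zero =>
    intro N _ _ _ ξ
    refine ⟨c, fun L _ _ a ha => ?_⟩
    obtain ⟨φ, rfl⟩ := Ext.homEquiv₀.symm.surjective ξ
    have h0 : ∀ y ∈ I ^ c • (⊤ : Submodule R N), φ.hom y = 0 := by
      intro y hy
      induction hy using Submodule.smul_induction_on' with
      | smul r hr n _ => rw [map_smul]; exact hc r hr _
      | add x _ y _ hx hy => rw [map_add, hx, hy, add_zero]
    have : ModuleCat.ofHom a ≫ φ = 0 := by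
      ext x
      exact h0 _ (ha ⟨x, rfl⟩)
    change (Ext.mk₀ (ModuleCat.ofHom a)).comp (Ext.mk₀ φ) _ = 0
    rw [Ext.mk₀_comp_mk₀, this, Ext.mk₀_zero]
  | succ j ih =>
    intro N _ _ _ ξ
    obtain ⟨n, π, hπ⟩ := Module.Finite.exists_fin' R N
    let K := LinearMap.ker π
    obtain ⟨η, hη⟩ := ext_shift K.subtype π K.subtype_injective hπ
      (by intro x; simp [K]) j ξ
    obtain ⟨k, hk⟩ := ih K η
    obtain ⟨k0, hk0⟩ := Ideal.exists_pow_inf_eq_pow_smul I K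
    refine ⟨k0 + k, fun L _ _ a ha => ?_⟩
    let m := k0 + k
    let F' : Submodule R (Fin n → R) := I ^ m • ⊤
    let N' : Submodule R N := I ^ m • ⊤
    have hmap : F'.map π = N' := by
      simp only [F', N', Submodule.map_smul'', Submodule.map_top, LinearMap.range_eq_top.2 hπ]
    have hF : ∀ x ∈ F', π x ∈ N' := fun x hx => hmap ▸ Submodule.mem_map_of_mem hx
    let π' : F' →ₗ[R] N' := π.restrict hF
    let K' := LinearMap.ker π'
    have hKK : ∀ x : K', ((x : F') : Fin n → R) ∈ K := by
      intro x
      have := x.2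
      rw [LinearMap.mem_ker] at this ⊢
      exact congrArg Subtype.val this
    let α : K' →ₗ[R] K := LinearMap.codRestrict K (F'.subtype ∘ₗ K'.subtype) hKK
    have h := hη K' F' N' K'.subtype π' K'.subtype_injective
      (by
        rintro ⟨y, hy⟩
        rw [← hmap] at hy
        obtain ⟨x, hx, rfl⟩ := hy
        exact ⟨⟨x, hx⟩, rfl⟩)
      (by intro x; simp [K']) α F'.subtype N'.subtype rfl rfl
      (hk _ _ (by
        rintro _ ⟨x, rfl⟩
        have h1 : ((x : F') : Fin n → R) ∈ I ^ m • (⊤ : Submodule R (Fin n → R)) ⊓ K := ⟨x.1.2, hKK x⟩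
        rw [hk0 m (by omega), show m - k0 = k by omega] at h1
        have h2 : ((x : F') : Fin n → R) ∈ I ^ k • K := Submodule.smul_mono le_rfl inf_le_right h1
        have h3 : (I ^ k • (⊤ : Submodule R K)).map K.subtype = I ^ k • K := by
          rw [Submodule.map_smul'', Submodule.map_top, Submodule.range_subtype]
        rw [← h3] at h2
        obtain ⟨y, hy, hyx⟩ := h2
        have : α x = y := Subtype.ext hyx.symm
        rw [this]; exact hy))
    let a' : L →ₗ[R] N' := LinearMap.codRestrict N' a (fun x => ha ⟨x, rfl⟩)
    have e : ModuleCat.ofHom a = ModuleCat.ofHom a' ≫ ModuleCat.ofHom N'.subtype := rfl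
    rw [e, ← Ext.mk₀_comp_mk₀_assoc, h, Ext.comp_zero]

lemma LC.vanish {M : Type u} [AddCommGroup M] [Module R M] (c : ℕ)
    (hc : ∀ r ∈ I ^ c, ∀ x : M, r • x = 0) (i : ℕ) (z : LC I (i + 1) M) : z = 0 := by
  obtain ⟨n, x, rfl⟩ := lof_exists I z
  have hex : ∀ n, Function.Exact (I ^ n).subtype (I ^ n).mkQ := by
    intro n x; simp [Ideal.Quotient.eq_zero_iff_mem]
  obtain ⟨η, hη⟩ := ext_shift (I ^ n).subtype (I ^ n).mkQ (I ^ n).subtype_injective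
    (I ^ n).mkQ_surjective (hex n) i x
  obtain ⟨k, hk⟩ := ext_restrict I c hc i (I ^ n : Ideal R) η
  have hle : n ≤ n + k := by omega
  rw [← lof_tr I hle x, tr_apply]
  have hpow : I ^ (n + k) ≤ I ^ n := Ideal.pow_le_pow_right hle
  have := hη (I ^ (n + k) : Ideal R) R (R ⧸ I ^ (n + k)) (I ^ (n+k)).subtype (I ^ (n+k)).mkQ
    (I ^ (n+k)).subtype_injective (I ^ (n+k)).mkQ_surjective (hex (n+k))
    (Submodule.inclusion hpow) LinearMap.id
    (Submodule.mapQ (I ^ (n+k)) (I ^ n) LinearMap.id hpow) rfl rfl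
    (hk _ _ (by
      rintro _ ⟨y, rfl⟩
      have h3 : (I ^ k • (⊤ : Submodule R (I ^ n : Ideal R))).map (I ^ n).subtype = I ^ (n+k) := by
        rw [Submodule.map_smul'', Submodule.map_top, Submodule.range_subtype, pow_add, mul_comm]
        rfl
      obtain ⟨w, hw⟩ := y
      have hw' := hw
      rw [← h3] at hw'
      obtain ⟨v, hv, hvx⟩ := hw'
      have : Submodule.inclusion hpow ⟨w, hw⟩ = v := Subtype.ext hvx.symm
      rw [this]; exact hv))
  rw [show (Ext.mk₀ (qmap I hle)).comp x (zero_add (i+1)) = 0 from this, _root_.map_zero]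

/-- degree zero -/
lemma LC.zero_equiv (I : Ideal R) (M : Type u) [AddCommGroup M] [Module R M] :
    ∃ f : LC I 0 M →ₗ[R] M, Function.Injective f ∧
      ∀ x : M, x ∈ LinearMap.range f ↔ ∃ n : ℕ, ∀ r ∈ I ^ n, r • x = 0 := by
  let ev : ∀ n, G I 0 M n →ₗ[R] M := fun n =>
    { toFun := fun x => (Ext.linearEquiv₀ (R := R) x).hom (Submodule.Quotient.mk 1)
      map_add' := by intro x y; simp
      map_smul' := by intro r x; simp }
  have hev : ∀ n (φ : QI I n ⟶ ModuleCat.of R M), ev n (Ext.mk₀ φ) = φ.hom (Submodule.Quotient.mk 1) := by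
    intro n φ
    change (Ext.linearEquiv₀ (R := R) (Ext.mk₀ φ)).hom _ = _
    congr 2
    exact (Ext.linearEquiv₀ (R := R)).symm.injective (by simp)
  have hrep : ∀ n (x : G I 0 M n), ∃ φ : QI I n ⟶ ModuleCat.of R M, x = Ext.mk₀ φ := fun n x =>
    ⟨Ext.linearEquiv₀ (R := R) x, by simp⟩
  let f : LC I 0 M →ₗ[R] M := Module.DirectLimit.lift R ℕ (G I 0 M) (tr I 0 M) ev (by
    intro m n h x
    obtain ⟨φ, rfl⟩ := hrep m x
    rw [tr_apply, Ext.mk₀_comp_mk₀, hev, hev]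
    rfl)
  have hf : ∀ n x, f (lof I 0 M n x) = ev n x := fun n x => Module.DirectLimit.lift_of _ _ _
  refine ⟨f, ?_, ?_⟩
  · rw [injective_iff_map_eq_zero]
    intro z hz
    obtain ⟨n, x, rfl⟩ := lof_exists I z
    obtain ⟨φ, rfl⟩ := hrep n x
    rw [hf, hev] at hz
    have : φ = 0 := by
      ext
      exact hz
    rw [this]; simp
  · intro x
    constructor
    · rintro ⟨z, rfl⟩
      obtain ⟨n, hn⟩ := LC.torsion I 0 z
      exact ⟨n, fun r hr => by rw [← LinearMap.map_smul, hn r hr, _root_.map_zero]⟩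
    · rintro ⟨n, hn⟩
      refine ⟨lof I 0 M n (Ext.mk₀ (ModuleCat.ofHom
        (Submodule.liftQ (I ^ n) (LinearMap.toSpanSingleton R M x) ?_))), ?_⟩
      · intro r hr; simpa using hn r hr
      · rw [hf, hev]
        exact (Submodule.liftQ_apply _ _ _).trans (one_smul R x)

end Vanish
end LCAux

namespace LCAux
section Matlis
open IsLocalRing

variable {R : Type u} [CommRing R]

lemma cofinite_tors (I : Ideal R) (L : ModuleCat.{u} R) (h : Module.Finite R
      (((Ext R (ModuleCat.{u} R) 0).obj (Opposite.op (ModuleCat.of R (R ⧸ I)))).obj L)) :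
    Module.Finite R (Submodule.torsionBySet R L (I : Set R)) := by
  let e := theta (ModuleCat.of R (R ⧸ I)) L 0 ≪≫ₗ Abelian.Ext.linearEquiv₀ (R := R)
  have h2 : Module.Finite R (ModuleCat.of R (R ⧸ I) ⟶ L) := Module.Finite.equiv e
  let ev : (ModuleCat.of R (R ⧸ I) ⟶ L) →ₗ[R] L :=
    { toFun := fun x => x.hom (Submodule.Quotient.mk 1)
      map_add' := by intro x y; simp
      map_smul' := by intro r x; simp }
  have h3 : LinearMap.range ev = Submodule.torsionBySet R L (I : Set R) := by
    ext x
    rw [Submodule.mem_torsionBySet_iff]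
    constructor
    · rintro ⟨φ, rfl⟩ ⟨r, hr⟩
      change r • φ.hom (Submodule.Quotient.mk 1) = 0
      rw [← LinearMap.map_smul, ← Submodule.Quotient.mk_smul,
        (Submodule.Quotient.mk_eq_zero _).2 (by simpa using hr), LinearMap.map_zero]
    · intro hx
      have hle : I ≤ LinearMap.ker (LinearMap.toSpanSingleton R L x) := fun r hr => hx ⟨r, hr⟩
      refine ⟨ModuleCat.ofHom (Submodule.liftQ I (LinearMap.toSpanSingleton R L x) hle), ?_⟩
      · exact (Submodule.liftQ_apply I (LinearMap.toSpanSingleton R L x) (h := hle) (1 : R)).trans (one_smul R x)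
  rw [← h3]
  infer_instance

/-- `E` is essential over `K` inside an ambient module. -/
def Ess {E : Type u} [AddCommGroup E] [Module R E] (K L : Submodule R E) : Prop :=
  K ≤ L ∧ ∀ x ∈ L, x ≠ 0 → ∃ r : R, r • x ∈ K ∧ r • x ≠ 0

lemma exists_E [IsLocalRing R] : ∃ (E : Type u) (_ : AddCommGroup E) (_ : Module R E),
    Module.Injective R E ∧ ∃ e : E, e ≠ 0 ∧ (∀ r ∈ maximalIdeal R, r • e = 0) ∧
      ∀ x : E, (∀ r ∈ maximalIdeal R, r • x = 0) → x ∈ Submodule.span R {e} := by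
  -- an injective module containing the residue field
  let k := ModuleCat.of R (R ⧸ maximalIdeal R)
  let E' := Injective.under k
  have hE' : Module.Injective R E' := by
    have : Injective (ModuleCat.of R E') := (inferInstance : Injective (Injective.under k))
    exact Module.injective_module_of_injective_object R E'
  have hι : Function.Injective (Injective.ι k).hom := (ModuleCat.mono_iff_injective _).1 inferInstance
  let e : E' := (Injective.ι k).hom (Submodule.Quotient.mk 1)
  have he0 : e ≠ 0 := by
    intro h
    have h1 := hι (h.trans (map_zero _).symm)
    rw [Submodule.Quotient.mk_eq_zero] at h1
    exact (Ideal.ne_top_iff_one _).1 (maximalIdeal.isMaximal R).ne_top h1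
  have hem : ∀ r ∈ maximalIdeal R, r • e = 0 := by
    intro r hr
    rw [← LinearMap.map_smul, ← Submodule.Quotient.mk_smul,
        (Submodule.Quotient.mk_eq_zero _).2 (by simpa using hr), LinearMap.map_zero]
  let K : Submodule R E' := Submodule.span R {e}
  obtain ⟨E, hKE, hEmax⟩ := zorn_le_nonempty₀ {L : Submodule R E' | Ess K L} (by
    intro c hc hchain L hL
    refine ⟨sSup c, ⟨(hc hL).1.trans (le_sSup hL), ?_⟩, fun z hz => le_sSup hz⟩
    intro x hx hx0
    obtain ⟨L', hL', hxL⟩ := (Submodule.mem_sSup_of_directed ⟨L, hL⟩ hchain.directedOn).1 hx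
    exact (hc hL').2 x hxL hx0) K ⟨le_rfl, fun x hx hx0 => ⟨1, by simpa using hx, by simpa using hx0⟩⟩
  have hE : Ess K E := hEmax.prop
  obtain ⟨C, -, hCmax⟩ := zorn_le_nonempty₀ {C : Submodule R E' | C ⊓ E = ⊥} (by
    intro c hc hchain L hL
    refine ⟨sSup c, ?_, fun z hz => le_sSup hz⟩
    rw [Set.mem_ofPred_eq, eq_bot_iff]
    rintro x ⟨hx, hxE⟩
    obtain ⟨L', hL', hxL⟩ := (Submodule.mem_sSup_of_directed ⟨L, hL⟩ hchain.directedOn).1 hx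
    have := hc hL'
    rw [Set.mem_ofPred_eq] at this
    rw [← this]
    exact ⟨hxL, hxE⟩) ⊥ (by simp)
  have hC : C ⊓ E = ⊥ := hCmax.prop
  -- E → E'/C is injective
  let j : E →ₗ[R] (E' ⧸ C) := C.mkQ ∘ₗ E.subtype
  have hj : Function.Injective j := by
    rw [injective_iff_map_eq_zero]
    intro x hx
    have h1 : (x : E') ∈ C := (Submodule.Quotient.mk_eq_zero _).1 hx
    have h2 : (x : E') ∈ C ⊓ E := ⟨h1, x.2⟩
    rw [hC] at h2
    exact Subtype.ext h2
  -- essential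
  have hess : ∀ y : E' ⧸ C, y ≠ 0 → ∃ r : R, ∃ x : E, j x = r • y ∧ r • y ≠ 0 := by
    intro y hy
    obtain ⟨y, rfl⟩ := C.mkQ_surjective y
    have hyC : y ∉ C := fun h => hy ((Submodule.Quotient.mk_eq_zero _).2 h)
    have hne : (C ⊔ Submodule.span R {y}) ⊓ E ≠ ⊥ := by
      intro h
      have := hCmax.le_of_ge h le_sup_left
      exact hyC (this (Submodule.mem_sup_right (Submodule.mem_span_singleton_self y)))
    obtain ⟨x, hx, hx0⟩ := Submodule.exists_mem_ne_zero_of_ne_bot hne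
    obtain ⟨c, hc, w, hw, hcw⟩ := Submodule.mem_sup.1 hx.1
    obtain ⟨r, rfl⟩ := Submodule.mem_span_singleton.1 hw
    have e1 : j ⟨x, hx.2⟩ = r • C.mkQ y := by
      change C.mkQ x = _
      rw [← hcw, map_add, map_smul]
      simp [(Submodule.Quotient.mk_eq_zero C).2 hc]
    refine ⟨r, ⟨x, hx.2⟩, e1, ?_⟩
    rw [← e1]
    intro h
    exact hx0 (congrArg Subtype.val (hj (h.trans (map_zero j).symm)))
  obtain ⟨h, hh⟩ := hE'.out j hj E.subtype
  have hinj : Function.Injective h := by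
    rw [injective_iff_map_eq_zero]
    intro y hy
    by_contra hy0
    obtain ⟨r, x, hx, hr0⟩ := hess y hy0
    have h1 : h (j x) = 0 := by rw [hx, map_smul, hy, smul_zero]
    rw [hh] at h1
    have : x = 0 := Subtype.ext h1
    rw [this, map_zero] at hx
    exact hr0 hx.symm
  have hrange : LinearMap.range h ≤ E := by
    apply hEmax.le_of_ge (y := LinearMap.range h)
    · refine ⟨fun x hx => ⟨j ⟨x, hE.1 hx⟩, hh _⟩, ?_⟩
      rintro _ ⟨y, rfl⟩ hy0
      have hy : y ≠ 0 := by rintro rfl; exact hy0 (map_zero h)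
      obtain ⟨r, x, hx, hr0⟩ := hess y hy
      have e1 : (x : E') = r • h y := by rw [← map_smul, ← hx, hh]; rfl
      have hx0 : (x : E') ≠ 0 := by
        rw [e1, ← map_smul]
        intro h0
        exact hr0 (hinj (h0.trans (map_zero h).symm))
      obtain ⟨s, hs, hs0⟩ := hE.2 x x.2 hx0
      rw [e1, smul_smul] at hs hs0
      exact ⟨s * r, hs, hs0⟩
    · intro x hx
      exact ⟨j ⟨x, hx⟩, hh _⟩
  let ρ : E' →ₗ[R] E := LinearMap.codRestrict E (h ∘ₗ C.mkQ) (fun x => hrange ⟨_, rfl⟩)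
  have hρ : ∀ x : E, ρ x = x := fun x => Subtype.ext (hh x)
  refine ⟨E, inferInstance, inferInstance, ⟨?_⟩, ⟨e, hE.1 (Submodule.mem_span_singleton_self e)⟩,
    ?_, ?_, ?_⟩
  · intro X Y _ _ _ _ f hf g
    obtain ⟨φ, hφ⟩ := hE'.out f hf (E.subtype ∘ₗ g)
    refine ⟨ρ ∘ₗ φ, fun x => ?_⟩
    rw [LinearMap.comp_apply, hφ]
    exact hρ _
  · intro h0
    exact he0 (congrArg Subtype.val h0)
  · intro r hr
    exact Subtype.ext (hem r hr)
  · intro x hx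
    by_cases hx0 : x = 0
    · rw [hx0]; exact Submodule.zero_mem _
    obtain ⟨r, hr, hr0⟩ := hE.2 x x.2 (fun h => hx0 (Subtype.ext h))
    have hru : IsUnit r := by
      by_contra hru
      exact hr0 (congrArg Subtype.val (hx r ((mem_maximalIdeal r).2 hru)))
    obtain ⟨u, rfl⟩ := hru
    obtain ⟨s, hs⟩ := Submodule.mem_span_singleton.1 hr
    rw [Submodule.mem_span_singleton]
    refine ⟨(u⁻¹ : Rˣ) * s, Subtype.ext ?_⟩
    change ((u⁻¹ : Rˣ) * s : R) • e = x
    rw [← smul_smul, hs, smul_smul, Units.inv_mul, one_smul]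

end Matlis
end LCAux

namespace LCAux
section Matlis2
open IsLocalRing

/-- An injective module with simple socle. -/
structure GoodE (R : Type u) [CommRing R] [IsLocalRing R] (E : Type u) [AddCommGroup E] [Module R E] :
    Prop where
  inj : Module.Injective R E
  soc : ∃ e : E, e ≠ 0 ∧ (∀ r ∈ maximalIdeal R, r • e = 0) ∧
      ∀ x : E, (∀ r ∈ maximalIdeal R, r • x = 0) → x ∈ Submodule.span R {e}

/-- m-power torsion modules -/
def MT (R : Type u) [CommRing R] [IsLocalRing R] (A : Type u) [AddCommGroup A] [Module R A] : Prop :=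
  ∀ a : A, ∃ n : ℕ, ∀ r ∈ maximalIdeal R ^ n, r • a = 0

variable {R : Type u} [CommRing R] [IsLocalRing R]
variable {E : Type u} [AddCommGroup E] [Module R E] (hE : GoodE R E)
variable {A B : Type u} [AddCommGroup A] [Module R A] [AddCommGroup B] [Module R B]

lemma MT.of_inj (h : MT R B) (f : A →ₗ[R] B) (hf : Function.Injective f) : MT R A := by
  intro a
  obtain ⟨n, hn⟩ := h (f a)
  exact ⟨n, fun r hr => hf (by rw [map_smul, hn r hr, map_zero])⟩

lemma MT.of_surj (h : MT R A) (f : A →ₗ[R] B) (hf : Function.Surjective f) : MT R B := by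
  intro b
  obtain ⟨a, rfl⟩ := hf b
  obtain ⟨n, hn⟩ := h a
  exact ⟨n, fun r hr => by rw [← map_smul, hn r hr, map_zero]⟩

lemma MT.sub (h : MT R A) (S : Submodule R A) : MT R S := h.of_inj S.subtype S.subtype_injective

/-- uniform exponent for finitely generated ones -/
lemma MT.fin (h : MT R A) [Module.Finite R A] :
    ∃ n : ℕ, ∀ r ∈ maximalIdeal R ^ n, ∀ a : A, r • a = 0 := by
  obtain ⟨s, hs⟩ := Module.Finite.fg_top (R := R) (M := A)
  choose N hN using h
  refine ⟨s.sup N, fun r hr a => ?_⟩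
  have ha : a ∈ Submodule.span R (s : Set A) := by rw [hs]; trivial
  induction ha using Submodule.span_induction with
  | mem x hx => exact hN x r (Ideal.pow_le_pow_right (Finset.le_sup hx) hr)
  | zero => simp
  | add x y _ _ hx hy => rw [smul_add, hx, hy, add_zero]
  | smul c x _ hx => rw [smul_comm, hx, smul_zero]

lemma MT.artinian [IsNoetherianRing R] [IsArtinian R A] : MT R A := by
  intro a
  let S : ℕ → Submodule R A := fun n => maximalIdeal R ^ n • Submodule.span R {a}
  have hS : Antitone S := fun m n h => Submodule.smul_mono (Ideal.pow_le_pow_right h) le_rfl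
  obtain ⟨n, hn⟩ := IsArtinian.monotone_stabilizes (R := R) (M := A) ⟨fun n => OrderDual.toDual (S n), hS⟩
  refine ⟨n, fun r hr => ?_⟩
  have h1 : S n = S (n+1) := hn (n+1) (by omega)
  have h2 : S n = ⊥ := by
    apply Submodule.eq_bot_of_le_smul_of_le_jacobson_bot (maximalIdeal R)
    · exact Submodule.FG.smul (IsNoetherian.noetherian (maximalIdeal R ^ n : Ideal R)) (Submodule.fg_span_singleton a)
    · conv_lhs => rw [h1]
      simp only [S]
      rw [pow_succ', ← smul_smul]
    · exact (IsLocalRing.jacobson_eq_maximalIdeal ⊥ bot_ne_top).ge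
  have h3 : r • a ∈ S n := Submodule.smul_mem_smul hr (Submodule.mem_span_singleton_self a)
  rw [h2] at h3
  exact h3

include hE in
lemma D_ext (f : A →ₗ[R] B) (hf : Function.Injective f) (g : A →ₗ[R] E) :
    ∃ h : B →ₗ[R] E, h ∘ₗ f = g := by
  obtain ⟨h, hh⟩ := hE.inj.out f hf g
  exact ⟨h, LinearMap.ext hh⟩

include hE in
lemma D_cogen (h : MT R A) (a : A) (ha : a ≠ 0) : ∃ f : A →ₗ[R] E, f a ≠ 0 := by
  classical
  have hex := h a
  let n := Nat.find hex
  have hn : ∀ r ∈ maximalIdeal R ^ n, r • a = 0 := Nat.find_spec hex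
  have hn0 : n ≠ 0 := by
    intro h0
    rw [h0] at hn
    exact ha (by simpa using hn 1 (by simp))
  have hmin := Nat.find_min hex (show n - 1 < n by omega)
  push Not at hmin
  obtain ⟨r, hr, hra⟩ := hmin
  have hmr : ∀ s ∈ maximalIdeal R, s • r • a = 0 := by
    intro s hs
    rw [smul_smul]
    apply hn
    have := Ideal.mul_mem_mul hs hr
    rwa [← pow_succ', show n - 1 + 1 = n by omega] at this
  obtain ⟨e, he0, hem, -⟩ := hE.soc
  let φ : (R ⧸ maximalIdeal R) →ₗ[R] A := Submodule.liftQ (maximalIdeal R)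
    (LinearMap.toSpanSingleton R A (r • a)) (fun s hs => hmr s hs)
  let ψ : (R ⧸ maximalIdeal R) →ₗ[R] E := Submodule.liftQ (maximalIdeal R)
    (LinearMap.toSpanSingleton R E e) (fun s hs => hem s hs)
  have hφ : Function.Injective φ := by
    rw [injective_iff_map_eq_zero]
    intro y hy
    obtain ⟨s, rfl⟩ := Submodule.mkQ_surjective _ y
    have h1 : s • r • a = 0 := hy
    by_contra hne
    have hs : IsUnit s := by
      by_contra hs
      exact hne ((Submodule.Quotient.mk_eq_zero _).2 ((mem_maximalIdeal s).2 hs))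
    exact hra ((hs.smul_eq_zero).1 h1)
  obtain ⟨f, hf⟩ := D_ext hE φ hφ ψ
  refine ⟨f, fun hfa => he0 ?_⟩
  have h1 : f (φ (Submodule.Quotient.mk 1)) = ψ (Submodule.Quotient.mk 1) := LinearMap.congr_fun hf _
  have h2 : φ (Submodule.Quotient.mk 1) = r • a :=
    (Submodule.liftQ_apply (maximalIdeal R) (LinearMap.toSpanSingleton R A (r • a))
      (h := fun s hs => hmr s hs) (1 : R)).trans (one_smul R _)
  have h3 : ψ (Submodule.Quotient.mk 1) = e :=
    (Submodule.liftQ_apply (maximalIdeal R) (LinearMap.toSpanSingleton R E e)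
      (h := fun s hs => hem s hs) (1 : R)).trans (one_smul R _)
  rw [h2, h3, map_smul, hfa, smul_zero] at h1
  exact h1.symm

include hE in
lemma D_ann (h : MT R A) : Module.annihilator R (A →ₗ[R] E) = Module.annihilator R A := by
  apply le_antisymm
  · intro r hr
    rw [Module.mem_annihilator] at hr ⊢
    intro a
    by_contra hra
    obtain ⟨f, hf⟩ := D_cogen hE h _ hra
    have := LinearMap.congr_fun (hr f) a
    rw [map_smul] at hf
    exact hf this
  · intro r hr
    rw [Module.mem_annihilator] at hr ⊢
    intro f
    ext a
    rw [LinearMap.smul_apply, ← map_smul, hr a, map_zero]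
    rfl

include hE in
lemma D_smul (J : Ideal R) (hJ : J.FG) (f : A →ₗ[R] E)
    (hf : ∀ a ∈ Submodule.torsionBySet R A (J : Set R), f a = 0) :
    f ∈ J • (⊤ : Submodule R (A →ₗ[R] E)) := by
  classical
  obtain ⟨s, rfl⟩ := hJ
  let μ : A →ₗ[R] (s → A) := LinearMap.pi (fun x => (x : R) • LinearMap.id)
  have hker : LinearMap.ker μ ≤ LinearMap.ker f := by
    intro a ha
    apply hf
    rw [Submodule.mem_torsionBySet_iff]
    rintro ⟨r, hr⟩
    change r • a = 0
    have hr' : r ∈ Submodule.span R (s : Set R) := hr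
    induction hr' using Submodule.span_induction with
    | mem x hx => exact congrFun (LinearMap.mem_ker.1 ha) ⟨x, hx⟩
    | zero => simp
    | add x y hx hy h1 h2 => rw [add_smul, h1 hx, h2 hy, add_zero]
    | smul c x hx h1 => rw [smul_assoc, h1 hx, smul_zero]
  let f' := (LinearMap.ker μ).liftQ f hker
  let μ' := (LinearMap.ker μ).liftQ μ le_rfl
  obtain ⟨h, hh⟩ := D_ext hE μ' (by
    rw [← LinearMap.ker_eq_bot]; exact Submodule.ker_liftQ_eq_bot _ _ _ le_rfl) f'
  have hfa : ∀ a, f a = h (μ a) := fun a => (LinearMap.congr_fun hh (Submodule.Quotient.mk a)).symm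
  have hsum : f = ∑ x : s, (x : R) • (h ∘ₗ LinearMap.single R (fun _ : s => A) x) := by
    ext a
    rw [hfa, LinearMap.sum_apply]
    conv_lhs => rw [← LinearMap.sum_single_apply (fun _ : s => A) (μ a), map_sum]
    apply Finset.sum_congr rfl
    intro x _
    rw [LinearMap.smul_apply, ← map_smul, LinearMap.comp_apply]
    rfl
  rw [hsum]
  exact Submodule.sum_mem _ fun x _ => Submodule.smul_mem_smul (Ideal.subset_span x.2) trivial

lemma D_smul_vanish (J : Ideal R) (f : A →ₗ[R] E) (hf : f ∈ J • (⊤ : Submodule R (A →ₗ[R] E)))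
    (a : A) (ha : ∀ r ∈ J, r • a = 0) : f a = 0 := by
  induction hf using Submodule.smul_induction_on' with
  | smul r hr n _ => rw [LinearMap.smul_apply, ← map_smul, ha r hr, map_zero]
  | add x _ y _ hx hy => rw [LinearMap.add_apply, hx, hy, add_zero]

lemma D_hausdorff (h : MT R A) : IsHausdorff (maximalIdeal R) (A →ₗ[R] E) := by
  constructor
  intro f hf
  ext a
  obtain ⟨n, hn⟩ := h a
  exact D_smul_vanish _ f (SModEq.zero.1 (hf n)) a hn

lemma mem_pi_smul (J : Ideal R) (r : ℕ) (x : Fin r → R) :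
    x ∈ J • (⊤ : Submodule R (Fin r → R)) ↔ ∀ i, x i ∈ J := by
  constructor
  · intro hx i
    induction hx using Submodule.smul_induction_on' with
    | smul r hr n _ => exact J.mul_mem_right _ hr
    | add x _ y _ hx hy => exact J.add_mem hx hy
  · intro h
    rw [pi_eq_sum_univ x]
    exact Submodule.sum_mem _ fun i _ => Submodule.smul_mem_smul (h i) trivial

lemma pi_precomplete [IsPrecomplete (maximalIdeal R) R] (r : ℕ) :
    IsPrecomplete (maximalIdeal R) (Fin r → R) := by
  constructor
  intro f hf
  have key : ∀ (i : Fin r), ∃ L : R, ∀ n, f n i ≡ L [SMOD (maximalIdeal R ^ n • ⊤ : Submodule R R)] := by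
    intro i
    apply IsPrecomplete.prec (I := maximalIdeal R) inferInstance
    intro m n hmn
    have := hf hmn
    rw [SModEq.sub_mem, mem_pi_smul] at this
    rw [SModEq.sub_mem]
    simpa using this i
  choose L hL using key
  refine ⟨L, fun n => ?_⟩
  rw [SModEq.sub_mem, mem_pi_smul]
  intro i
  have := hL i n
  rw [SModEq.sub_mem] at this
  simpa using this

variable [IsNoetherianRing R] [IsAdicComplete (maximalIdeal R) R]

include hE in
lemma D_fin (h : MT R A) (J : Ideal R) (hJ : J ≤ maximalIdeal R)
    (hfin : Module.Finite R (Submodule.torsionBySet R A (J : Set R) →ₗ[R] E)) :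
    Module.Finite R (A →ₗ[R] E) := by
  let T := Submodule.torsionBySet R A (J : Set R)
  let ρ : (A →ₗ[R] E) →ₗ[R] (T →ₗ[R] E) := LinearMap.lcomp R E T.subtype
  have : IsNoetherian R (T →ₗ[R] E) := isNoetherian_of_isNoetherianRing_of_finite _ _
  have : Module.Finite R (LinearMap.range ρ) := inferInstance
  obtain ⟨n, g, hg⟩ := Module.Finite.exists_fin' R (LinearMap.range ρ)
  obtain ⟨g', hg'⟩ := Module.projective_lifting_property ρ.rangeRestrict g ρ.surjective_rangeRestrict
  have := pi_precomplete (R := R) n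
  have := D_hausdorff (E := E) h
  apply Module.Finite.of_surjective g'
  apply surjective_of_mkQ_comp_surjective (I := maximalIdeal R)
  intro y
  obtain ⟨y, rfl⟩ := Submodule.mkQ_surjective _ y
  obtain ⟨x, hx⟩ := hg (ρ.rangeRestrict y)
  refine ⟨x, ?_⟩
  rw [LinearMap.comp_apply, ← sub_eq_zero, ← map_sub]
  apply (Submodule.Quotient.mk_eq_zero _).2
  apply Submodule.smul_mono_left hJ
  apply D_smul hE J (IsNoetherian.noetherian J)
  intro a ha
  have h1 : ρ.rangeRestrict (g' x) = ρ.rangeRestrict y := by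
    rw [← LinearMap.comp_apply, hg', hx]
  have h2 := congrArg Subtype.val h1
  have h3 := LinearMap.congr_fun h2 ⟨a, ha⟩
  rw [LinearMap.sub_apply, sub_eq_zero]
  exact h3

include hE in
lemma D_fin_of_fin (h : MT R A) (hfin : Module.Finite R
    (Submodule.torsionBySet R A (maximalIdeal R : Set R))) : Module.Finite R (A →ₗ[R] E) := by
  apply D_fin hE h _ le_rfl
  let T := Submodule.torsionBySet R A (maximalIdeal R : Set R)
  obtain ⟨n, g, hg⟩ := Module.Finite.exists_fin' R T
  obtain ⟨e, he0, hem, hes⟩ := hE.soc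
  let S := Submodule.span R {e}
  have hT : ∀ (f : T →ₗ[R] E) t, f t ∈ S := by
    intro f t
    apply hes
    intro r hr
    rw [← map_smul]
    have : r • t = 0 := Subtype.ext ((Submodule.mem_torsionBySet_iff _ _).1 t.2 ⟨r, hr⟩)
    rw [this, map_zero]
  let Φ : (T →ₗ[R] E) →ₗ[R] (Fin n → S) := LinearMap.pi fun i =>
    { toFun := fun f => ⟨f (g (Pi.single i 1)), hT f _⟩
      map_add' := fun _ _ => rfl
      map_smul' := fun _ _ => rfl }
  have : Module.Finite R S := Module.Finite.span_singleton R e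
  have : IsNoetherian R (Fin n → S) := isNoetherian_of_isNoetherianRing_of_finite _ _
  apply Module.Finite.of_injective Φ
  rw [injective_iff_map_eq_zero]
  intro f hf
  have : f ∘ₗ g = 0 := by
    apply LinearMap.pi_ext'
    intro i
    ext
    exact congrArg Subtype.val (congrFun hf i)
  ext t
  obtain ⟨x, rfl⟩ := hg t
  exact LinearMap.congr_fun this x

include hE in
lemma D_fin_of_finite (h : MT R A) [Module.Finite R A] : Module.Finite R (A →ₗ[R] E) := by
  have : IsNoetherian R A := isNoetherian_of_isNoetherianRing_of_finite _ _
  exact D_fin_of_fin hE h inferInstance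

lemma tors_fin_of_artinian [IsArtinian R A] :
    Module.Finite R (Submodule.torsionBySet R A (maximalIdeal R : Set R)) := by
  let T := Submodule.torsionBySet R A (maximalIdeal R : Set R)
  have hT : Module.IsTorsionBySet R T (maximalIdeal R : Set R) :=
    Submodule.torsionBySet_isTorsionBySet _
  let : Module (R ⧸ maximalIdeal R) T := hT.module
  have : IsScalarTower R (R ⧸ maximalIdeal R) T := hT.isScalarTower
  let : Field (R ⧸ maximalIdeal R) := Ideal.Quotient.field _
  have : IsArtinian (R ⧸ maximalIdeal R) T := isArtinian_of_tower R inferInstance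
  have : Module.Finite (R ⧸ maximalIdeal R) T := by
    let b := Module.Basis.ofVectorSpace (R ⧸ maximalIdeal R) T
    have hb := b.linearIndependent.linearIndepOn_id
    have := IsArtinian.finite_of_linearIndependent hb
    have : Finite (Module.Basis.ofVectorSpaceIndex (R ⧸ maximalIdeal R) T) :=
      Set.finite_range_iff b.injective |>.1 this
    exact Module.Finite.of_basis b
  exact Module.Finite.trans (R ⧸ maximalIdeal R) T

include hE in
lemma D_fin_of_artinian [IsArtinian R A] : Module.Finite R (A →ₗ[R] E) :=
  D_fin_of_fin hE MT.artinian tors_fin_of_artinian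

/-- The cofinite step. -/
lemma cofinite_step (I : Ideal R) (hI : I ≤ maximalIdeal R) [IsArtinian R A]
    (hfin : Module.Finite R (Submodule.torsionBySet R A (I : Set R))) :
    maximalIdeal R ≤ (I ⊔ Module.annihilator R A).radical := by
  obtain ⟨E, _, _, h1, h2⟩ := exists_E (R := R)
  have hE : GoodE R E := ⟨h1, h2⟩
  have hMT : MT R A := MT.artinian
  have hD := D_fin_of_artinian (A := A) hE
  obtain ⟨n, hn⟩ := (hMT.sub (Submodule.torsionBySet R A (I : Set R))).fin
  intro x hx
  have hxn : ∀ f : A →ₗ[R] E, x ^ n • f ∈ I • (⊤ : Submodule R (A →ₗ[R] E)) := by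
    intro f
    apply D_smul hE I (IsNoetherian.noetherian I)
    intro a ha
    rw [LinearMap.smul_apply, ← map_smul]
    have := congrArg Subtype.val (hn (x ^ n) (Ideal.pow_mem_pow hx n) ⟨a, ha⟩)
    change x ^ n • a = 0 at this
    rw [this, map_zero]
  obtain ⟨p, hp, -, hc, he⟩ := LinearMap.exists_monic_and_natDegree_eq_and_coeff_mem_pow_and_aeval_eq_zero
    R (algebraMap R (Module.End R (A →ₗ[R] E)) (x ^ n)) I (by
      rintro _ ⟨f, rfl⟩
      exact hxn f)
  have h5 : p.eval (x ^ n) ∈ Module.annihilator R A := by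
    rw [← D_ann hE hMT, Module.mem_annihilator]
    intro f
    rw [Polynomial.aeval_algebraMap_apply] at he
    have := LinearMap.congr_fun he f
    simpa using this
  have h6 : (x ^ n) ^ p.natDegree ∈ I ⊔ Module.annihilator R A := by
    rw [Polynomial.eval_eq_sum_range, Finset.sum_range_succ, hp.coeff_natDegree, one_mul] at h5
    have h7 : ∑ i ∈ Finset.range p.natDegree, p.coeff i * (x ^ n) ^ i ∈ I := by
      apply Ideal.sum_mem
      intro i hi
      rw [Finset.mem_range] at hi
      exact I.mul_mem_right _ (Ideal.pow_le_self (by omega) (hc i))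
    have := Ideal.sub_mem _ (Submodule.mem_sup_right (S := I) h5) (Submodule.mem_sup_left h7)
    simpa using this
  exact ⟨n * p.natDegree, by rwa [pow_mul]⟩

end Matlis2
end LCAux

namespace LCAux
section Dim
open IsLocalRing

variable {R : Type u} [CommRing R] [IsLocalRing R] [IsNoetherianRing R]

/-- the dimension of `R/q` -/
noncomputable def dm (q : PrimeSpectrum R) : ℕ := (Order.coheight q).toNat

lemma dm_coe (q : PrimeSpectrum R) : ((dm q : ℕ) : ℕ∞) = Order.coheight q := by
  apply ENat.coe_toNat
  have h1 : (Order.coheight q : WithBot ℕ∞) ≤ ringKrullDim R := Order.coheight_le_krullDim q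
  have h2 : ringKrullDim R < ⊤ := ringKrullDim_lt_top
  intro h
  rw [h] at h1
  exact absurd (h1.trans_lt h2) (lt_irrefl _)

lemma dm_lt {p q : PrimeSpectrum R} (h : p < q) : dm q < dm p := by
  have := Order.coheight_strictAnti h (by rw [← dm_coe]; exact ENat.coe_lt_top _)
  rw [← dm_coe, ← dm_coe] at this
  exact_mod_cast this

lemma dm_le {p q : PrimeSpectrum R} (h : p ≤ q) : dm q ≤ dm p := by
  rcases h.lt_or_eq with h | rfl
  · exact (dm_lt h).le
  · exact le_rfl

lemma dm_dim (q : PrimeSpectrum R) : ringKrullDim (R ⧸ q.asIdeal) = ((dm q : ℕ∞) : WithBot ℕ∞) := by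
  rw [ringKrullDim_quotient, dm_coe, Order.coheight_eq_krullDim_Ici]
  have : PrimeSpectrum.zeroLocus (q.asIdeal : Set R) = Set.Ici q := by
    ext x; rfl
  rw [this]

lemma dm_eq_of_le {p q : PrimeSpectrum R} (h : p ≤ q) (hd : dm p ≤ dm q) : p = q := by
  rcases h.lt_or_eq with h | h
  · have := dm_lt h; omega
  · exact h

lemma le_closed (p : PrimeSpectrum R) : p ≤ closedPoint R :=
  (IsLocalRing.le_maximalIdeal p.2.ne_top)

lemma dm_closed : dm (closedPoint R) = 0 := by
  have : Order.coheight (closedPoint R) = 0 := by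
    rw [Order.coheight_eq_zero]
    intro b hb
    exact le_closed b
  have h2 := dm_coe (closedPoint R)
  rw [this] at h2
  exact_mod_cast h2

lemma eq_closed {p : PrimeSpectrum R} (h : dm p = 0) : p = closedPoint R :=
  dm_eq_of_le (le_closed p) (by omega)

lemma dm_le_add (p : PrimeSpectrum R) (x : R) (hx : x ∈ maximalIdeal R) :
    ∃ q : PrimeSpectrum R, p ≤ q ∧ x ∈ q.asIdeal ∧ dm p ≤ dm q + 1 := by
  have h1 := Module.supportDim_le_supportDim_quotSMulTop_succ (R := R) (M := R ⧸ p.asIdeal) hx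
  have h2 : Module.supportDim R (R ⧸ p.asIdeal) = ((dm p : ℕ∞) : WithBot ℕ∞) := by
    rw [← dm_dim, ringKrullDim_quotient, Module.supportDim, Module.support_eq_zeroLocus,
      Ideal.annihilator_quotient]
  rw [h2] at h1
  have h3 : ((dm p - 1 : ℕ) : WithBot ℕ∞) ≤ Order.krullDim (Module.support R (QuotSMulTop x (R ⧸ p.asIdeal))) := by
    change _ ≤ Module.supportDim R (QuotSMulTop x (R ⧸ p.asIdeal)) + 1 at h1
    change _ ≤ Module.supportDim R (QuotSMulTop x (R ⧸ p.asIdeal))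
    generalize Module.supportDim R (QuotSMulTop x (R ⧸ p.asIdeal)) = d at h1
    induction d using WithBot.recBotCoe with
    | bot => simp at h1
    | coe d =>
      induction d using ENat.recTopCoe with
      | top => exact le_top
      | coe d =>
        have : dm p ≤ d + 1 := by exact_mod_cast h1
        have : dm p - 1 ≤ d := by omega
        exact WithBot.coe_le_coe.2 (Nat.cast_le.2 this)
  obtain ⟨l, hl⟩ := Order.le_krullDim_iff.1 h3
  have hs := Module.support_quotSMulTop (R := R) (M := R ⧸ p.asIdeal) x
  have hq := hs.subset l.head.2
  rw [Module.support_eq_zeroLocus, Ideal.annihilator_quotient] at hq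
  refine ⟨l.head.1, hq.1, by simpa using hq.2, ?_⟩
  have h4 := Order.length_le_coheight (p := l.map Subtype.val (fun _ _ h => h)) (x := l.head.1) le_rfl
  rw [← dm_coe] at h4
  have h5 : l.length ≤ dm l.head.1 := by exact_mod_cast h4
  omega

end Dim
end LCAux

namespace LCAux
section LCbasic
open IsLocalRing

variable {R : Type u} [CommRing R] (I : Ideal R)
variable {M N P : Type u} [AddCommGroup M] [Module R M] [AddCommGroup N] [Module R N]
  [AddCommGroup P] [Module R P]

/-- vanishing of local cohomology -/
def Z (i : ℕ) (M : Type u) [AddCommGroup M] [Module R M] : Prop := ∀ z : LC I i M, z = 0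

lemma LC.map_add (i : ℕ) (f g : M →ₗ[R] N) (z : LC I i M) :
    LC.map I i (f + g) z = LC.map I i f z + LC.map I i g z := by
  obtain ⟨n, x, rfl⟩ := lof_exists I z
  simp [LC.map, lmap_lof, gmap_apply, ModuleCat.ofHom_add, Abelian.Ext.mk₀_add, Abelian.Ext.comp_add]

lemma LC.map_sum (i : ℕ) {ι : Type*} (s : Finset ι) (f : ι → M →ₗ[R] N) (z : LC I i M) :
    LC.map I i (∑ j ∈ s, f j) z = ∑ j ∈ s, LC.map I i (f j) z := by
  classical
  induction s using Finset.induction_on with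
  | empty => simp [LC.map_zero]
  | insert a s ha ih => rw [Finset.sum_insert ha, Finset.sum_insert ha, LC.map_add, ih]

lemma LC.ann (i : ℕ) : Module.annihilator R M ≤ Module.annihilator R (LC I i M) := by
  intro r hr
  rw [Module.mem_annihilator] at hr ⊢
  intro z
  have h := LC.map_smul I i r (LinearMap.id : M →ₗ[R] M) z
  have h0 : r • (LinearMap.id : M →ₗ[R] M) = 0 := by ext x; exact hr x
  rw [h0, LC.map_zero, LC.map_id] at h
  exact h.symm

lemma LC.map_mono_zero (f : M →ₗ[R] N) (hf : Function.Injective f) :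
    Function.Injective (LC.map I 0 f) := by
  rw [injective_iff_map_eq_zero]
  intro z hz
  obtain ⟨n, x, rfl⟩ := lof_exists I z
  rw [LC.map, lmap_lof] at hz
  obtain ⟨m, hm, hz⟩ := lof_zero I hz
  rw [← lof_tr I hm]
  rw [← gmap_apply, ← gmap_tr] at hz
  generalize tr I 0 M n m hm x = y at *
  obtain ⟨φ, rfl⟩ : ∃ φ : QI I m ⟶ ModuleCat.of R M, y = Abelian.Ext.mk₀ φ :=
    ⟨Abelian.Ext.linearEquiv₀ (R := R) y, by simp⟩
  rw [gmap_apply, Abelian.Ext.mk₀_comp_mk₀] at hz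
  have h1 : φ ≫ ModuleCat.ofHom f = 0 := by
    have := (Abelian.Ext.mk₀_eq_zero_iff _).1 hz
    exact this
  have h2 : φ = 0 := by
    ext a
    apply hf
    have := congrArg (fun ψ => ψ.hom (Submodule.Quotient.mk 1)) h1
    simpa using this
  rw [h2]
  simp

lemma LC.surj_of_Z (f : M →ₗ[R] N) (g : N →ₗ[R] P) (hf : Function.Injective f)
    (hg : Function.Surjective g) (hfg : Function.Exact f g) (i : ℕ) (h : Z I (i+1) M) :
    Function.Surjective (LC.map I i g) := by
  obtain ⟨δ, h1, h2, h3⟩ := LC.exact I f g hf hg hfg i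
  intro z
  exact (h2 z).1 (h _)

lemma LC.surj_of_Z' (g : N →ₗ[R] P) (hg : Function.Surjective g) (i : ℕ)
    (h : Z I (i+1) (LinearMap.ker g)) : Function.Surjective (LC.map I i g) :=
  LC.surj_of_Z I (LinearMap.ker g).subtype g (Submodule.subtype_injective _) hg
    (LinearMap.exact_subtype_ker_map g) i h

lemma Z.mid {f : M →ₗ[R] N} {g : N →ₗ[R] P} (hf : Function.Injective f)
    (hg : Function.Surjective g) (hfg : Function.Exact f g) {i : ℕ} (h : Z I i M) (h' : Z I i P) :
    Z I i N := by
  obtain ⟨δ, h1, h2, h3⟩ := LC.exact I f g hf hg hfg i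
  intro z
  obtain ⟨y, rfl⟩ := (h1 z).1 (h' _)
  rw [h y, _root_.map_zero]

lemma Z.right {f : M →ₗ[R] N} {g : N →ₗ[R] P} (hf : Function.Injective f)
    (hg : Function.Surjective g) (hfg : Function.Exact f g) {i : ℕ} (h : Z I i N) (h' : Z I (i+1) M) :
    Z I i P := by
  intro z
  obtain ⟨y, rfl⟩ := LC.surj_of_Z I f g hf hg hfg i h' z
  rw [h y, _root_.map_zero]

lemma LC.map_equiv_inj (e : M ≃ₗ[R] N) (i : ℕ) : Function.Injective (LC.map I i e.toLinearMap) := by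
  intro x y h
  have := congrArg (LC.map I i e.symm.toLinearMap) h
  simpa [← LC.map_comp, LC.map_id] using this

lemma Z.equiv (e : M ≃ₗ[R] N) {i : ℕ} (h : Z I i N) : Z I i M := fun z =>
  LC.map_equiv_inj I e i ((h _).trans (_root_.map_zero _).symm)

lemma Z.subsingleton [Subsingleton M] (i : ℕ) : Z I i M := by
  intro z
  rw [← LC.map_id I i z, Subsingleton.elim (LinearMap.id : M →ₗ[R] M) 0, LC.map_zero]

lemma Z.of_fg_ann {i : ℕ} (h : Z I i M) : Module.annihilator R (LC I i M) = ⊤ := by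
  rw [Ideal.eq_top_iff_one, Module.mem_annihilator]
  intro z; rw [h z, smul_zero]

/-- multiplication by an element on a quotient by a prime -/
def mulx (p : Ideal R) (x : R) : (R ⧸ p) →ₗ[R] (R ⧸ p) := x • LinearMap.id

lemma mulx_inj (p : Ideal R) [p.IsPrime] (x : R) (hx : x ∉ p) : Function.Injective (mulx p x) := by
  rw [injective_iff_map_eq_zero]
  intro y hy
  obtain ⟨s, rfl⟩ := Ideal.Quotient.mk_surjective y
  have h : Ideal.Quotient.mk p (x * s) = 0 := hy
  rw [Ideal.Quotient.eq_zero_iff_mem] at h ⊢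
  exact (Ideal.IsPrime.mem_or_mem ‹_› h).resolve_left hx

lemma ann_mulx (p : Ideal R) (x : R) :
    p ≤ Module.annihilator R ((R ⧸ p) ⧸ LinearMap.range (mulx p x)) ∧
    x ∈ Module.annihilator R ((R ⧸ p) ⧸ LinearMap.range (mulx p x)) := by
  constructor
  · intro r hr
    rw [Module.mem_annihilator]
    intro y
    obtain ⟨y, rfl⟩ := Submodule.mkQ_surjective _ y
    obtain ⟨s, rfl⟩ := Ideal.Quotient.mk_surjective y
    rw [← map_smul]
    have : r • (Ideal.Quotient.mk p s) = 0 := by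
      change Ideal.Quotient.mk p (r * s) = 0
      rw [Ideal.Quotient.eq_zero_iff_mem]
      exact p.mul_mem_right _ hr
    rw [this, _root_.map_zero]
  · rw [Module.mem_annihilator]
    intro y
    obtain ⟨y, rfl⟩ := Submodule.mkQ_surjective _ y
    rw [← map_smul]
    exact (Submodule.Quotient.mk_eq_zero _).2 ⟨y, rfl⟩

variable [IsNoetherianRing R] [IsLocalRing R]

/-- Grothendieck vanishing -/
lemma vanishing (i : ℕ) : ∀ (M : Type u) [AddCommGroup M] [Module R M] [Module.Finite R M],
    (∀ q : PrimeSpectrum R, Module.annihilator R M ≤ q.asIdeal → dm q < i) → Z I i M := by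
  induction i with
  | zero =>
    intro M _ _ _ h
    have : Module.annihilator R M = ⊤ := by
      by_contra hne
      exact absurd (h (closedPoint R) (le_maximalIdeal hne)) (by omega)
    rw [Module.annihilator_eq_top_iff] at this
    exact Z.subsingleton I 0
  | succ j ih =>
    intro M _ _ hfin
    refine IsNoetherianRing.induction_on_isQuotientEquivQuotientPrime R hfin
      (motive := fun N _ _ _ => (∀ q : PrimeSpectrum R, Module.annihilator R N ≤ q.asIdeal →
        dm q < j + 1) → Z I (j+1) N) ?_ ?_ ?_
    · intro N _ _ _ _ _
      exact Z.subsingleton I _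
    · intro N _ _ _ p e h
      apply Z.equiv I e
      have hp : dm p ≤ j := by
        have := h p (by rw [e.annihilator_eq, Ideal.annihilator_quotient])
        omega
      by_cases hI : I ≤ p.asIdeal
      · intro z
        apply LC.vanish I 1 _ j z
        intro r hr x
        obtain ⟨s, rfl⟩ := Ideal.Quotient.mk_surjective x
        change Ideal.Quotient.mk _ (r * s) = 0
        rw [Ideal.Quotient.eq_zero_iff_mem]
        rw [pow_one] at hr
        exact p.asIdeal.mul_mem_right _ (hI hr)
      · obtain ⟨x, hxI, hxp⟩ := SetLike.not_le_iff_exists.1 hI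
        let f := mulx p.asIdeal x
        obtain ⟨δ, h1, h2, h3⟩ := LC.exact I f (LinearMap.range f).mkQ (mulx_inj _ x hxp)
          (Submodule.mkQ_surjective _) (LinearMap.exact_map_mkQ_range f) j
        have hz : Z I j ((R ⧸ p.asIdeal) ⧸ LinearMap.range f) := by
          apply ih
          intro q hq
          have hpq : p < q := by
            refine lt_of_le_of_ne ((ann_mulx _ x).1.trans hq) ?_
            rintro rfl
            exact hxp (hq (ann_mulx _ x).2)
          exact (dm_lt hpq).trans_le hp
        have hinj : ∀ z : LC I (j+1) (R ⧸ p.asIdeal), x • z = 0 → z = 0 := by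
          intro z hxz
          have : LC.map I (j+1) f z = 0 := by
            change LC.map I (j+1) (x • LinearMap.id) z = 0
            rw [LC.map_smul, LC.map_id, hxz]
          obtain ⟨w, rfl⟩ := (h3 z).1 this
          rw [hz w, _root_.map_zero]
        intro z
        obtain ⟨n, hn⟩ := LC.torsion I (j+1) z
        replace hn := hn (x ^ n) (Ideal.pow_mem_pow hxI n)
        clear h1 h2 h3
        induction n with
        | zero => simpa using hn
        | succ n ihn =>
          apply ihn
          apply hinj
          rw [smul_smul, ← pow_succ', hn]
    · intro N₁ _ _ _ N₂ _ _ _ N₃ _ _ _ f g hf hg hfg m1 m3 h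
      exact Z.mid I hf hg hfg (m1 fun q hq => h q ((f.annihilator_le_of_injective hf).trans hq))
        (m3 fun q hq => h q ((g.annihilator_le_of_surjective hg).trans hq))

/-- cohomological dimension bounds the cohomology of all finite modules -/
lemma cd_all (t : ℕ) (h : ∀ i, t < i → Z I i R) (i : ℕ) (hi : t < i) (M : Type u) [AddCommGroup M]
    [Module R M] [Module.Finite R M] : Z I i M := by
  obtain ⟨D, hD⟩ : ∃ D : ℕ, ∀ q : PrimeSpectrum R, dm q ≤ D := by
    have h1 : ringKrullDim R ≠ ⊤ := ringKrullDim_lt_top.ne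
    have h0 : ringKrullDim R ≠ ⊥ := ringKrullDim_ne_bot
    obtain ⟨d, hd⟩ := WithBot.ne_bot_iff_exists.1 h0
    rw [← hd] at h1
    obtain ⟨n, rfl⟩ := ENat.ne_top_iff_exists.1 (fun h => h1 (by rw [h]; rfl) : d ≠ ⊤)
    refine ⟨n, fun q => ?_⟩
    have h2 : (Order.coheight q : WithBot ℕ∞) ≤ ringKrullDim R := Order.coheight_le_krullDim q
    rw [← hd, ← dm_coe, WithBot.coe_le_coe] at h2
    exact_mod_cast h2
  have key : ∀ k i : ℕ, t < i → D < i + k → ∀ (M : Type u) [AddCommGroup M]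
      [Module R M] [Module.Finite R M], Z I i M := by
    intro k
    induction k with
    | zero => intro i _ hi M _ _ _; exact vanishing I i M fun q _ => (hD q).trans_lt (by omega)
    | succ k ih =>
      intro i hti hi M _ _ hfin
      refine IsNoetherianRing.induction_on_isQuotientEquivQuotientPrime R hfin
        (motive := fun N _ _ _ => Z I i N) ?_ ?_ ?_
      · intro N _ _ _ _
        exact Z.subsingleton I _
      · intro N _ _ _ p e
        apply Z.equiv I e
        exact Z.right I (Submodule.subtype_injective p.asIdeal) (Submodule.mkQ_surjective p.asIdeal)
          (LinearMap.exact_subtype_mkQ p.asIdeal) (h i hti) (ih (i+1) (by omega) (by omega) _)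
      · intro N₁ _ _ _ N₂ _ _ _ N₃ _ _ _ f g hf hg hfg m1 m3
        exact Z.mid I hf hg hfg m1 m3
  exact key (D + 1) i hi (by omega) M

lemma im_le (t : ℕ) (h : ∀ i, t < i → Z I i R) (a : Ideal R) (z : LC I t a) :
    LC.map I t a.subtype z ∈ a • (⊤ : Submodule R (LC I t R)) := by
  obtain ⟨n, g, hg⟩ := Module.Finite.exists_fin' R a
  obtain ⟨w, rfl⟩ := LC.surj_of_Z' I g hg t (cd_all I t h _ (by omega) _) z
  rw [← LC.map_comp]
  have : a.subtype ∘ₗ g = ∑ j : Fin n, (g (Pi.single j 1) : R) • LinearMap.proj j := by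
    apply LinearMap.pi_ext'
    intro i
    ext
    simp [Pi.single_apply]
  rw [this, LC.map_sum]
  apply Submodule.sum_mem
  intro j _
  rw [LC.map_smul]
  exact Submodule.smul_mem_smul (g (Pi.single j 1)).2 trivial

end LCbasic
end LCAux

namespace LCAux
section LOne
open IsLocalRing

variable {R : Type u} [CommRing R] [IsLocalRing R] [IsNoetherianRing R] (I : Ideal R)
variable {M N P : Type u} [AddCommGroup M] [Module R M] [AddCommGroup N] [Module R N]
  [AddCommGroup P] [Module R P]

/-- the radical condition on a module -/
def RC (M : Type u) [AddCommGroup M] [Module R M] : Prop :=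
  maximalIdeal R ≤ (I ⊔ Module.annihilator R M).radical

lemma RC.mono {I : Ideal R} (h : RC I M) (h' : Module.annihilator R M ≤ Module.annihilator R N) : RC I N :=
  h.trans (Ideal.radical_mono (sup_le_sup_left h' I))

lemma RC.mt {I : Ideal R} (h : RC I M) (i : ℕ) : MT R (LC I i M) := by
  intro z
  obtain ⟨n, hn⟩ := LC.torsion I i z
  obtain ⟨k, hk⟩ := Ideal.exists_pow_le_of_le_radical_of_fg h (IsNoetherian.noetherian _)
  have h2 : (I ⊔ Module.annihilator R M) ^ (n + 1) ≤ I ^ n ⊔ Module.annihilator R M := by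
    have := Ideal.sup_pow_add_le_pow_sup_pow (I := I) (J := Module.annihilator R M) (n := n) (m := 1)
    rwa [pow_one] at this
  refine ⟨k * (n + 1), fun r hr => ?_⟩
  rw [pow_mul] at hr
  obtain ⟨a, ha, b, hb, rfl⟩ := Submodule.mem_sup.1 (h2 (Ideal.pow_right_mono hk (n + 1) hr))
  rw [add_smul, hn a ha, Module.mem_annihilator.1 (LC.ann I i hb), add_zero]

/-- I-power torsion submodule -/
def Gam (M : Type u) [AddCommGroup M] [Module R M] : Submodule R M where
  carrier := {x | ∃ n : ℕ, ∀ r ∈ I ^ n, r • x = 0}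
  zero_mem' := ⟨0, by simp⟩
  add_mem' := by
    rintro x y ⟨n, hn⟩ ⟨m, hm⟩
    refine ⟨n + m, fun r hr => ?_⟩
    rw [smul_add, hn r (Ideal.pow_le_pow_right (by omega) hr), hm r (Ideal.pow_le_pow_right (by omega) hr),
      add_zero]
  smul_mem' := by
    rintro c x ⟨n, hn⟩
    exact ⟨n, fun r hr => by rw [smul_comm, hn r hr, smul_zero]⟩

lemma Gam_unif [Module.Finite R M] : ∃ c : ℕ, ∀ r ∈ I ^ c, ∀ x : Gam I M, r • x = 0 := by
  have : IsNoetherian R M := isNoetherian_of_isNoetherianRing_of_finite _ _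
  obtain ⟨s, hs⟩ := Module.Finite.fg_top (R := R) (M := Gam I M)
  have h : ∀ x : Gam I M, ∃ n : ℕ, ∀ r ∈ I ^ n, r • x = 0 := by
    rintro ⟨x, n, hn⟩
    exact ⟨n, fun r hr => Subtype.ext (hn r hr)⟩
  choose n hn using h
  refine ⟨s.sup n, fun r hr a => ?_⟩
  have ha : a ∈ Submodule.span R (s : Set (Gam I M)) := by rw [hs]; trivial
  induction ha using Submodule.span_induction with
  | mem x hx => exact hn x r (Ideal.pow_le_pow_right (Finset.le_sup hx) hr)
  | zero => simp
  | add x y _ _ hx hy => rw [smul_add, hx, hy, add_zero]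
  | smul c x _ hx => rw [smul_comm, hx, smul_zero]

lemma exists_reg [Module.Finite R M] : ∃ x ∈ I, IsSMulRegular (M ⧸ Gam I M) x := by
  classical
  by_contra hcon
  push Not at hcon
  let S := (associatedPrimes.finite R (M ⧸ Gam I M)).toFinset
  have hsub : (I : Set R) ⊆ ⋃ p ∈ (S : Set (Ideal R)), ((id p : Ideal R) : Set R) := by
    intro x hx
    have : x ∈ {r | IsSMulRegular (M ⧸ Gam I M) r}ᶜ := hcon x hx
    rw [← biUnion_associatedPrimes_eq_compl_regular] at this
    simpa [S] using this
  rw [Ideal.subset_union_prime ⊤ ⊤] at hsub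
  · obtain ⟨p, hp, hIp⟩ := hsub
    have hp' : p ∈ associatedPrimes R (M ⧸ Gam I M) := by simpa [S] using hp
    obtain ⟨hpp, y, hy⟩ := (Submodule.isAssociatedPrime_iff (N := (⊥ : Submodule R (M ⧸ Gam I M)))).1 hp'
    obtain ⟨v, rfl⟩ := Submodule.mkQ_surjective _ y
    obtain ⟨c, hc⟩ := Gam_unif I (M := M)
    have hv : v ∈ Gam I M := by
      refine ⟨c + 1, fun r hr => ?_⟩
      rw [pow_succ] at hr
      induction hr using Submodule.mul_induction_on' with
      | mem_mul_mem a ha b hb =>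
        have hb' : b ∈ p := hIp hb
        rw [hy, Submodule.mem_colon_singleton, ← _root_.map_smul] at hb'
        have hb2 : b • v ∈ Gam I M := (Submodule.Quotient.mk_eq_zero _).1 ((Submodule.mem_bot R).1 hb')
        rw [mul_smul]
        exact congrArg Subtype.val (hc a ha ⟨_, hb2⟩)
      | add a _ b _ ha hb => rw [add_smul, ha, hb, add_zero]
    have h0 : (Gam I M).mkQ v = 0 := (Submodule.Quotient.mk_eq_zero _).2 hv
    apply hpp.ne_top
    rw [hy, h0, Ideal.eq_top_iff_one, Submodule.mem_colon_singleton]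
    simp
  · intro p hp _ _
    have hp' : p ∈ associatedPrimes R (M ⧸ Gam I M) := by simpa [S] using hp
    exact hp'.1

lemma D_fin_sub {E : Type u} [AddCommGroup E] [Module R E] (hE : GoodE R E) (f : M →ₗ[R] N)
    (hf : Function.Injective f) [Module.Finite R (N →ₗ[R] E)] : Module.Finite R (M →ₗ[R] E) :=
  Module.Finite.of_surjective (LinearMap.lcomp R E f) (fun g => D_ext hE f hf g)

lemma D_fin_quot {E : Type u} [AddCommGroup E] [Module R E] (f : M →ₗ[R] N)
    (hf : Function.Surjective f) [Module.Finite R (M →ₗ[R] E)] : Module.Finite R (N →ₗ[R] E) := by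
  have : IsNoetherian R (M →ₗ[R] E) := isNoetherian_of_isNoetherianRing_of_finite _ _
  apply Module.Finite.of_injective (LinearMap.lcomp R E f)
  intro g h hgh
  ext n
  obtain ⟨m, rfl⟩ := hf n
  exact LinearMap.congr_fun hgh m

/-- The key finiteness and dimension estimate. -/
lemma LOne [IsAdicComplete (maximalIdeal R) R] (hI : I ≤ maximalIdeal R)
    {E : Type u} [AddCommGroup E] [Module R E] (hE : GoodE R E) (i : ℕ) :
    ∀ (M : Type u) [AddCommGroup M] [Module R M] [Module.Finite R M], RC I M →
      Module.Finite R (LC I i M →ₗ[R] E) ∧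
      ∀ q : PrimeSpectrum R, Module.annihilator R (LC I i M) ≤ q.asIdeal → dm q ≤ i := by
  induction i with
  | zero =>
    intro M _ _ _ hM
    obtain ⟨f, hf, -⟩ := LC.zero_equiv I M
    have : IsNoetherian R M := isNoetherian_of_isNoetherianRing_of_finite _ _
    have hfin : Module.Finite R (LC I 0 M) := Module.Finite.of_injective f hf
    have hMT := hM.mt 0
    refine ⟨D_fin_of_finite hE hMT, fun q hq => ?_⟩
    obtain ⟨n, hn⟩ := hMT.fin
    have h1 : maximalIdeal R ^ n ≤ q.asIdeal := fun r hr =>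
      hq (Module.mem_annihilator.2 fun a => hn r hr a)
    have h2 : maximalIdeal R ≤ q.asIdeal := Ideal.IsPrime.le_of_pow_le h1
    have h3 : closedPoint R ≤ q := h2
    have := dm_le h3
    rw [dm_closed] at this
    exact this
  | succ j ih =>
    intro M _ _ _ hM
    obtain ⟨c, hc⟩ := Gam_unif I (M := M)
    obtain ⟨δ, h1, h2, h3⟩ := LC.exact I (Gam I M).subtype (Gam I M).mkQ (Submodule.subtype_injective _)
      (Submodule.mkQ_surjective _) (LinearMap.exact_subtype_mkQ _) (j+1)
    have hinj : Function.Injective (LC.map I (j+1) (Gam I M).mkQ) := by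
      rw [injective_iff_map_eq_zero]
      intro z hz
      obtain ⟨w, rfl⟩ := (h1 z).1 hz
      rw [LC.vanish I c hc j w, _root_.map_zero]
    clear h1 h2 h3 δ
    obtain ⟨x, hxI, hx⟩ := exists_reg I (M := M)
    let M1 := M ⧸ Gam I M
    have hM1 : RC I M1 := hM.mono ((Gam I M).mkQ.annihilator_le_of_surjective (Submodule.mkQ_surjective _))
    let f : M1 →ₗ[R] M1 := x • LinearMap.id
    have hf : Function.Injective f := hx
    let N := M1 ⧸ LinearMap.range f
    have hN : RC I N := hM1.mono ((LinearMap.range f).mkQ.annihilator_le_of_surjective (Submodule.mkQ_surjective _))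
    obtain ⟨hNfin, hNdim⟩ := ih N hN
    obtain ⟨δ, -, -, h3⟩ := LC.exact I f (LinearMap.range f).mkQ hf
      (Submodule.mkQ_surjective _) (LinearMap.exact_map_mkQ_range f) j
    let A1 := LC I (j+1) M1
    have hA1 : MT R A1 := hM1.mt (j+1)
    let J := Ideal.span {x}
    have hJ : J ≤ maximalIdeal R := (Ideal.span_singleton_le_iff_mem _).2 (hI hxI)
    let T := Submodule.torsionBySet R A1 (J : Set R)
    have hT : ∀ a : A1, a ∈ T ↔ ∃ w, δ w = a := by
      intro a
      have : LC.map I (j+1) f a = x • a := by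
        change LC.map I (j+1) (x • LinearMap.id) a = _
        rw [LC.map_smul, LC.map_id]
      have h4 := h3 a
      rw [this] at h4
      rw [← Set.mem_range, ← h4]
      rw [Submodule.mem_torsionBySet_iff]
      constructor
      · intro h; exact h ⟨x, Ideal.mem_span_singleton_self x⟩
      · rintro h ⟨r, hr⟩
        obtain ⟨s, rfl⟩ := Ideal.mem_span_singleton'.1 hr
        change (s * x) • a = 0
        rw [mul_smul, h, smul_zero]
    let δ' : LC I j N →ₗ[R] T := δ.codRestrict T (fun w => (hT _).2 ⟨w, rfl⟩)
    have hδ' : Function.Surjective δ' := by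
      rintro ⟨a, ha⟩
      obtain ⟨w, hw⟩ := (hT a).1 ha
      exact ⟨w, Subtype.ext hw⟩
    have hTfin : Module.Finite R (T →ₗ[R] E) := D_fin_quot δ' hδ'
    have hK : Module.Finite R (A1 →ₗ[R] E) := D_fin hE hA1 J hJ hTfin
    refine ⟨D_fin_sub hE _ hinj, fun q hq => ?_⟩
    have hq1 : Module.annihilator R A1 ≤ q.asIdeal :=
      (LinearMap.annihilator_le_of_injective _ hinj).trans hq
    obtain ⟨q', hqq', hxq', hd⟩ := dm_le_add q x (hI hxI)
    have hq' : Module.annihilator R (LC I j N) ≤ q'.asIdeal := by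
      have hsupp : q' ∈ Module.support R (QuotSMulTop x (A1 →ₗ[R] E)) := by
        rw [Module.support_quotSMulTop]
        refine ⟨?_, by simpa using hxq'⟩
        rw [Module.support_eq_zeroLocus, D_ann hE hA1]
        exact hq1.trans hqq'
      rw [Module.support_eq_zeroLocus] at hsupp
      refine le_trans ?_ hsupp
      intro r hr
      rw [Module.mem_annihilator]
      intro y
      obtain ⟨g, rfl⟩ := Submodule.mkQ_surjective _ y
      rw [← _root_.map_smul]
      apply (Submodule.Quotient.mk_eq_zero _).2
      have : r • g ∈ J • (⊤ : Submodule R (A1 →ₗ[R] E)) := by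
        apply D_smul hE J (IsNoetherian.noetherian J)
        intro a ha
        obtain ⟨w, rfl⟩ := (hT a).1 ha
        rw [LinearMap.smul_apply, ← _root_.map_smul, ← _root_.map_smul, Module.mem_annihilator.1 hr, _root_.map_zero,
          _root_.map_zero]
      rwa [Submodule.ideal_span_singleton_smul] at this
    have := hNdim q' hq'
    omega

end LOne
end LCAux

namespace LCAux
section LThree
open IsLocalRing

variable {R : Type u} [CommRing R] [IsLocalRing R] [IsNoetherianRing R] (I : Ideal R)

lemma RC.quot {p : PrimeSpectrum R} (h : maximalIdeal R ≤ (I ⊔ p.asIdeal).radical) :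
    RC I (R ⧸ p.asIdeal) := by
  rw [RC, Ideal.annihilator_quotient]; exact h

lemma ann_of_nonzero (p : PrimeSpectrum R) (h : ∃ z : LC I (dm p) (R ⧸ p.asIdeal), z ≠ 0) :
    Module.annihilator R (LC I (dm p) (R ⧸ p.asIdeal)) = p.asIdeal := by
  apply le_antisymm
  · intro x hx
    by_contra hxp
    obtain ⟨z, hz⟩ := h
    apply hz
    let f := mulx p.asIdeal x
    obtain ⟨δ, h1, h2, h3⟩ := LC.exact I f (LinearMap.range f).mkQ (mulx_inj _ x hxp)
      (Submodule.mkQ_surjective _) (LinearMap.exact_map_mkQ_range f) (dm p)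
    have hz0 : Z I (dm p) ((R ⧸ p.asIdeal) ⧸ LinearMap.range f) := by
      apply vanishing
      intro q hq
      have hpq : p < q := by
        refine lt_of_le_of_ne ((ann_mulx _ x).1.trans hq) ?_
        rintro rfl
        exact hxp (hq (ann_mulx _ x).2)
      exact dm_lt hpq
    obtain ⟨w, rfl⟩ := (h1 z).1 (hz0 _)
    change LC.map I (dm p) (x • LinearMap.id) w = 0
    rw [LC.map_smul, LC.map_id]
    exact Module.mem_annihilator.1 hx w
  · conv_lhs => rw [← Ideal.annihilator_quotient (I := p.asIdeal)]
    exact LC.ann I _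

variable [IsAdicComplete (maximalIdeal R) R] 

/-- Nonvanishing -/
lemma LThree (hI : I ≤ maximalIdeal R) (t : ℕ) : ∀ p : PrimeSpectrum R,
    maximalIdeal R ≤ (I ⊔ p.asIdeal).radical → dm p = t → ∃ z : LC I t (R ⧸ p.asIdeal), z ≠ 0 := by
  classical
  induction t with
  | zero =>
    intro p _ hp
    rw [eq_closed hp]
    change ∃ z : LC I 0 (R ⧸ maximalIdeal R), z ≠ 0
    obtain ⟨f, hf, hr⟩ := LC.zero_equiv I (R ⧸ maximalIdeal R)
    obtain ⟨z, hz⟩ := (hr (Submodule.Quotient.mk 1)).2 ⟨1, fun r hr => by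
      rw [pow_one] at hr
      rw [← Submodule.Quotient.mk_smul]
      apply (Submodule.Quotient.mk_eq_zero _).2
      simpa using hI hr⟩
    refine ⟨z, fun h0 => ?_⟩
    rw [h0, _root_.map_zero] at hz
    have := (Submodule.Quotient.mk_eq_zero (maximalIdeal R)).1 hz.symm
    exact (maximalIdeal.isMaximal R).ne_top ((Ideal.eq_top_iff_one _).2 this)
  | succ j ih =>
    intro p hrad hp
    by_contra hcon
    push Not at hcon
    obtain ⟨E, _, _, hE1, hE2⟩ := exists_E (R := R)
    have hE : GoodE R E := ⟨hE1, hE2⟩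
    have hRC := RC.quot I hrad
    have hK := (LOne I hI hE j (R ⧸ p.asIdeal) hRC).1
    let K := LC I j (R ⧸ p.asIdeal) →ₗ[R] E
    have hfin : (associatedPrimes R K).Finite := associatedPrimes.finite R K
    let S : Finset (Ideal R) := insert p.asIdeal (hfin.toFinset.erase (maximalIdeal R))
    have hpm : p.asIdeal ≠ maximalIdeal R := by
      intro h
      have : p = closedPoint R := PrimeSpectrum.ext h
      rw [this, dm_closed] at hp
      omega
    have hSp : ∀ a ∈ S, a.IsPrime ∧ a ≠ maximalIdeal R := by
      intro a ha
      rw [Finset.mem_insert, Finset.mem_erase] at ha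
      rcases ha with rfl | ⟨ha, ha'⟩
      · exact ⟨p.2, hpm⟩
      · exact ⟨((Set.Finite.mem_toFinset _).1 ha').1, ha⟩
    obtain ⟨x, hxm, hxS⟩ : ∃ x ∈ maximalIdeal R, ∀ a ∈ S, x ∉ a := by
      by_contra hno
      push Not at hno
      have hsub : (maximalIdeal R : Set R) ⊆ ⋃ a ∈ (S : Set (Ideal R)), ((id a : Ideal R) : Set R) := by
        intro x hx
        obtain ⟨a, ha, hxa⟩ := hno x hx
        simp only [Set.mem_iUnion]
        exact ⟨a, ha, hxa⟩
      rw [Ideal.subset_union_prime (f := id) ⊤ ⊤ (fun a ha _ _ => (hSp a ha).1)] at hsub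
      obtain ⟨a, ha, hma⟩ := hsub
      exact (hSp a ha).2 (le_antisymm (le_maximalIdeal (hSp a ha).1.ne_top) hma)
    have hxp : x ∉ p.asIdeal := hxS _ (Finset.mem_insert_self _ _)
    obtain ⟨q, hpq, hxq, hd⟩ := dm_le_add p x hxm
    have hpq' : p < q := lt_of_le_of_ne hpq (by rintro rfl; exact hxp hxq)
    have hqj : dm q = j := by
      have := dm_lt hpq'
      omega
    have hradq : maximalIdeal R ≤ (I ⊔ q.asIdeal).radical :=
      hrad.trans (Ideal.radical_mono (sup_le_sup_left hpq I))
    have hne := ih q hradq hqj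
    have hann : Module.annihilator R (LC I j (R ⧸ q.asIdeal)) = q.asIdeal := by
      subst hqj
      exact ann_of_nonzero I q hne
    -- surjection
    let f := mulx p.asIdeal x
    have hs1 : Function.Surjective (LC.map I j (LinearMap.range f).mkQ) :=
      LC.surj_of_Z I f (LinearMap.range f).mkQ (mulx_inj _ x hxp)
        (Submodule.mkQ_surjective _) (LinearMap.exact_map_mkQ_range f) j hcon
    let g0 : (R ⧸ p.asIdeal) →ₗ[R] (R ⧸ q.asIdeal) := Submodule.mapQ p.asIdeal q.asIdeal LinearMap.id hpq
    let g : ((R ⧸ p.asIdeal) ⧸ LinearMap.range f) →ₗ[R] (R ⧸ q.asIdeal) :=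
      (LinearMap.range f).liftQ g0 (by
        rintro _ ⟨y, rfl⟩
        rw [LinearMap.mem_ker]
        change g0 (x • y) = 0
        rw [_root_.map_smul]
        obtain ⟨s, hs⟩ := Ideal.Quotient.mk_surjective (g0 y)
        rw [← hs]
        change Ideal.Quotient.mk _ (x * s) = 0
        rw [Ideal.Quotient.eq_zero_iff_mem]
        exact q.asIdeal.mul_mem_right _ hxq)
    have hg : Function.Surjective g := by
      intro y
      obtain ⟨s, rfl⟩ := Submodule.mkQ_surjective _ y
      exact ⟨Submodule.Quotient.mk (Submodule.Quotient.mk s), rfl⟩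
    have hs2 : Function.Surjective (LC.map I j g) := by
      apply LC.surj_of_Z' I g hg
      apply vanishing
      intro a ha
      have h1 : Module.annihilator R ((R ⧸ p.asIdeal) ⧸ LinearMap.range f) ≤ a.asIdeal :=
        (LinearMap.annihilator_le_of_injective _ (Submodule.subtype_injective (LinearMap.ker g))).trans ha
      have hpa : p < a := by
        refine lt_of_le_of_ne ((ann_mulx _ x).1.trans h1) ?_
        rintro rfl
        exact hxp (h1 (ann_mulx _ x).2)
      have := dm_lt hpa
      omega
    let σ := LC.map I j g ∘ₗ LC.map I j (LinearMap.range f).mkQ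
    have hσ : Function.Surjective σ := hs2.comp hs1
    let K' := LC I j (R ⧸ q.asIdeal) →ₗ[R] E
    have hK' : Module.Finite R K' := D_fin_quot σ hσ
    have hK'ann : Module.annihilator R K' = q.asIdeal := by
      rw [D_ann hE ((RC.quot I hradq).mt j), hann]
    have hqK' : q.asIdeal ∈ associatedPrimes R K' := by
      apply Module.associatedPrimes.minimalPrimes_annihilator_subset_associatedPrimes
      rw [hK'ann, Ideal.minimalPrimes_eq_subsingleton_self]
      rfl
    have hqK : q.asIdeal ∈ associatedPrimes R K := by
      refine associatedPrimes.subset_of_injective (f := LinearMap.lcomp R E σ) ?_ hqK'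
      intro a b hab
      ext n
      obtain ⟨m, rfl⟩ := hσ n
      exact LinearMap.congr_fun hab m
    by_cases hqm : q.asIdeal = maximalIdeal R
    · have hqc : q = closedPoint R := PrimeSpectrum.ext hqm
      have hj0 : j = 0 := by rw [← hqj, hqc, dm_closed]
      subst hj0
      obtain ⟨z, hz⟩ := hne
      obtain ⟨w, rfl⟩ := hσ z
      obtain ⟨φ, hφ, hr⟩ := LC.zero_equiv I (R ⧸ p.asIdeal)
      obtain ⟨n, hn⟩ := (hr (φ w)).1 ⟨w, rfl⟩
      have hw : φ w ≠ 0 := by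
        intro h
        have : w = 0 := hφ (by rw [h, _root_.map_zero])
        exact hz (by rw [this, _root_.map_zero])
      have hIp : I ^ n ≤ p.asIdeal := by
        intro r hr
        have h1 := hn r hr
        by_contra hrp
        exact hw (mulx_inj p.asIdeal r hrp (by rw [_root_.map_zero]; exact h1))
      have hIp2 : I ≤ p.asIdeal := Ideal.IsPrime.le_of_pow_le hIp
      rw [sup_eq_right.2 hIp2, p.2.isRadical.radical] at hrad
      exact hpm (le_antisymm (le_maximalIdeal p.2.ne_top) hrad)
    · exact hxS q.asIdeal (Finset.mem_insert_of_mem (Finset.mem_erase.2 ⟨hqm, by simpa using hqK⟩)) hxq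

lemma LThree_ann (hI : I ≤ maximalIdeal R) (p : PrimeSpectrum R)
    (h : maximalIdeal R ≤ (I ⊔ p.asIdeal).radical) :
    Module.annihilator R (LC I (dm p) (R ⧸ p.asIdeal)) = p.asIdeal :=
  ann_of_nonzero I p (LThree I hI _ p h rfl)

lemma ann_le_of_surj {M N : Type u} [AddCommGroup M] [Module R M] [AddCommGroup N] [Module R N]
    (f : M →ₗ[R] N) (hf : Function.Surjective f) : Module.annihilator R M ≤ Module.annihilator R N :=
  f.annihilator_le_of_surjective hf

lemma LTwo (hI : I ≤ maximalIdeal R) (p : PrimeSpectrum R) (M : Type u) [AddCommGroup M]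
    [Module R M] [hfin : Module.Finite R M] : RC I M →
    (∀ q : PrimeSpectrum R, Module.annihilator R M ≤ q.asIdeal → dm q ≤ dm p) →
    Module.annihilator R M ≤ p.asIdeal → Module.annihilator R (LC I (dm p) M) ≤ p.asIdeal := by
  refine IsNoetherianRing.induction_on_isQuotientEquivQuotientPrime R hfin
      (motive := fun N _ _ _ => RC I N →
    (∀ q : PrimeSpectrum R, Module.annihilator R N ≤ q.asIdeal → dm q ≤ dm p) →
    Module.annihilator R N ≤ p.asIdeal → Module.annihilator R (LC I (dm p) N) ≤ p.asIdeal) ?_ ?_ ?_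
  · intro N _ _ _ hN _ _ hp
    rw [Module.annihilator_eq_top_iff.2 hN] at hp
    exact absurd (top_le_iff.1 hp) p.2.ne_top
  · intro N _ _ _ q e hRC hdim hp
    have hq : q = p := by
      rw [e.annihilator_eq, Ideal.annihilator_quotient] at hp
      exact dm_eq_of_le hp (hdim q (by rw [e.annihilator_eq, Ideal.annihilator_quotient]))
    subst hq
    have hrad : maximalIdeal R ≤ (I ⊔ q.asIdeal).radical := by
      rw [RC, e.annihilator_eq, Ideal.annihilator_quotient] at hRC
      exact hRC
    rw [← LThree_ann I hI q hrad]
    conv_rhs => rw [LThree_ann I hI q hrad, ← LThree_ann I hI q hrad]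
    apply LinearMap.annihilator_le_of_injective _ (LC.map_equiv_inj I e.symm _)
  · intro N₁ _ _ _ N₂ _ _ _ N₃ _ _ _ f g hf hg hfg m1 m3 hRC hdim hp
    have ha1 := f.annihilator_le_of_injective hf
    have ha3 := g.annihilator_le_of_surjective hg
    by_cases h3 : Module.annihilator R N₃ ≤ p.asIdeal
    · have hsurj : Function.Surjective (LC.map I (dm p) g) := by
        apply LC.surj_of_Z I f g hf hg hfg
        apply vanishing
        intro q hq
        exact Nat.lt_succ_of_le (hdim q (ha1.trans hq))
      exact (LinearMap.annihilator_le_of_surjective _ hsurj).trans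
        (m3 (hRC.mono ha3) (fun q hq => hdim q (ha3.trans hq)) h3)
    · obtain ⟨s, hs, hsp⟩ := SetLike.not_le_iff_exists.1 h3
      have h1 : Module.annihilator R N₁ ≤ p.asIdeal := by
        intro r hr
        have : r * s ∈ Module.annihilator R N₂ := by
          rw [Module.mem_annihilator]
          intro y
          have : g (s • y) = 0 := by rw [_root_.map_smul, Module.mem_annihilator.1 hs]
          obtain ⟨w, hw⟩ := (hfg _).1 this
          rw [mul_smul, ← hw, ← _root_.map_smul, Module.mem_annihilator.1 hr, _root_.map_zero]
        exact (p.2.mem_or_mem (hp this)).resolve_right hsp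
      have h2 := m1 (hRC.mono ha1) (fun q hq => hdim q (ha1.trans hq)) h1
      intro r hr
      suffices hsr : s * r ∈ Module.annihilator R (LC I (dm p) N₁) from
        (p.2.mem_or_mem (h2 hsr)).resolve_left hsp
      rw [Module.mem_annihilator]
      intro z
      have hz : LC.map I (dm p) f (r • z) = 0 := by
        rw [_root_.map_smul, Module.mem_annihilator.1 hr]
      rw [mul_smul]
      clear m1 m3 hdim h2 hr
      generalize dm p = t at *
      cases t with
      | zero => rw [LC.map_mono_zero I f hf (hz.trans (_root_.map_zero _).symm), smul_zero]
      | succ j =>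
        obtain ⟨δ, -, -, h5⟩ := LC.exact I f g hf hg hfg j
        obtain ⟨w, hw⟩ := (h5 _).1 hz
        rw [← hw, ← _root_.map_smul, Module.mem_annihilator.1 (LC.ann I j hs), _root_.map_zero]

end LThree
end LCAux

namespace LCAux
section Final
open IsLocalRing

variable {R : Type u} [CommRing R] [IsLocalRing R] [IsNoetherianRing R]

lemma minimal_of_kill (P : PrimeSpectrum R) (n : ℕ) (s : R) (hs : s ∉ P.asIdeal)
    (h : ∀ y ∈ P.asIdeal ^ n, s * y ∈ P.asIdeal ^ (n + 1)) (q : PrimeSpectrum R) (hq : q ≤ P) : q = P := by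
  let L := P.asIdeal ^ n
  obtain ⟨f, hf, -, hc, he⟩ := LinearMap.exists_monic_and_natDegree_eq_and_coeff_mem_pow_and_aeval_eq_zero
    R (algebraMap R (Module.End R L) s) P.asIdeal (by
      rintro _ ⟨y, rfl⟩
      change s • y ∈ P.asIdeal • (⊤ : Submodule R L)
      have h1 := h y.1 y.2
      rw [pow_succ'] at h1
      have h2 : (P.asIdeal • (⊤ : Submodule R L)).map L.subtype = P.asIdeal * P.asIdeal ^ n := by
        rw [Submodule.map_smul'', Submodule.map_top, Submodule.range_subtype]
        rfl
      rw [← h2] at h1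
      obtain ⟨w, hw, hw2⟩ := h1
      have : w = s • y := Subtype.ext hw2
      rwa [← this])
  have h5 : ∀ y ∈ L, f.eval s * y = 0 := by
    intro y hy
    rw [Polynomial.aeval_algebraMap_apply] at he
    have := congrArg Subtype.val (LinearMap.congr_fun he ⟨y, hy⟩)
    simpa using this
  have h6 : f.eval s ∉ P.asIdeal := by
    intro h5
    rw [Polynomial.eval_eq_sum_range, Finset.sum_range_succ, hf.coeff_natDegree, one_mul] at h5
    have h7 : ∑ i ∈ Finset.range f.natDegree, f.coeff i * s ^ i ∈ P.asIdeal := by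
      apply Ideal.sum_mem
      intro i hi
      rw [Finset.mem_range] at hi
      exact P.asIdeal.mul_mem_right _ (Ideal.pow_le_self (by omega) (hc i))
    have h8 := (Ideal.add_mem_iff_right _ h7).1 h5
    exact hs (P.2.mem_of_pow_mem _ h8)
  apply le_antisymm hq
  have h9 : P.asIdeal ^ n ≤ q.asIdeal := by
    intro y hy
    have := h5 y hy
    exact (q.2.mem_or_mem (this ▸ q.asIdeal.zero_mem)).resolve_left (fun h => h6 (hq h))
  exact Ideal.IsPrime.le_of_pow_le h9

variable [IsAdicComplete (maximalIdeal R) R]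

lemma core_minimal (I : Ideal R) (hI : I ≤ maximalIdeal R) (P : PrimeSpectrum R)
    (hcd : ∀ i, dm P < i → Z I i R) [IsArtinian R (LC I (dm P) R)]
    (hrad : maximalIdeal R ≤ (I ⊔ P.asIdeal).radical) (q : PrimeSpectrum R) (hq : q ≤ P) : q = P := by
  let p := P.asIdeal
  let fac : ∀ n, (R ⧸ p ^ (n + 1)) →ₗ[R] (R ⧸ p ^ n) := fun n =>
    Submodule.mapQ (p ^ (n + 1)) (p ^ n) LinearMap.id (Ideal.pow_le_pow_right (Nat.le_succ n))
  have hfac : ∀ n, (p ^ n).mkQ = fac n ∘ₗ (p ^ (n + 1)).mkQ := fun n => rfl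
  let N : ℕ → Submodule R (LC I (dm P) R) := fun n => LinearMap.ker (LC.map I (dm P) (p ^ n).mkQ)
  have hN : Antitone N := by
    apply antitone_nat_of_succ_le
    intro n z hz
    rw [LinearMap.mem_ker] at hz ⊢
    rw [hfac, LC.map_comp, hz, _root_.map_zero]
  obtain ⟨n, hn⟩ := IsArtinian.monotone_stabilizes (R := R) (M := LC I (dm P) R)
    ⟨fun n => OrderDual.toDual (N n), hN⟩
  have hstab : N n = N (n + 1) := hn (n + 1) (by omega)
  have hRCn : ∀ k, RC I (R ⧸ p ^ k) := by
    intro k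
    rw [RC, Ideal.annihilator_quotient]
    refine hrad.trans ?_
    rw [Ideal.radical_le_radical_iff]
    refine sup_le (le_sup_left.trans Ideal.le_radical) ?_
    intro x hx
    exact ⟨k, Submodule.mem_sup_right (Ideal.pow_mem_pow hx k)⟩
  have hinj : Function.Injective (LC.map I (dm P) (fac n)) := by
    rw [injective_iff_map_eq_zero]
    intro z hz
    obtain ⟨w, rfl⟩ := LC.surj_of_Z' I (p ^ (n + 1)).mkQ (Submodule.mkQ_surjective _) (dm P)
      (cd_all I (dm P) hcd _ (by omega) _) z
    rw [← LC.map_comp, ← hfac] at hz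
    have hw : w ∈ N n := hz
    rw [hstab] at hw
    exact hw
  let L := LinearMap.ker (fac n)
  have hfs : Function.Surjective (fac n) := by
    intro y
    obtain ⟨s, rfl⟩ := Submodule.mkQ_surjective _ y
    exact ⟨Submodule.Quotient.mk s, rfl⟩
  have hLann : p ^ (n + 1) ≤ Module.annihilator R L := by
    refine le_trans ?_ (LinearMap.annihilator_le_of_injective _ (Submodule.subtype_injective L))
    rw [Ideal.annihilator_quotient]
  have hLdim : ∀ a : PrimeSpectrum R, Module.annihilator R L ≤ a.asIdeal → dm a ≤ dm P := by
    intro a ha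
    have : P ≤ a := Ideal.IsPrime.le_of_pow_le (hLann.trans ha)
    exact dm_le this
  have hLRC : RC I L :=
    (hRCn (n + 1)).mono (LinearMap.annihilator_le_of_injective _ (Submodule.subtype_injective L))
  have hnot : ¬ Module.annihilator R (LC I (dm P) L) ≤ p := by
    intro hle
    have hz : ∀ z, LC.map I (dm P) L.subtype z = 0 := by
      intro z
      apply hinj
      rw [← LC.map_comp, _root_.map_zero]
      have : fac n ∘ₗ L.subtype = 0 := by
        ext y
        exact y.2
      rw [this, LC.map_zero]
    have hL1 : ∀ j, j + 1 = dm P → Module.annihilator R (LC I j (R ⧸ p ^ n)) ≤ p → False := by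
      intro j hj hle
      obtain ⟨E, _, _, hE1, hE2⟩ := exists_E (R := R)
      have := (LOne I hI ⟨hE1, hE2⟩ j (R ⧸ p ^ n) (hRCn n)).2 P hle
      omega
    generalize dm P = t at *
    cases t with
    | zero =>
      have : Z I 0 L := fun z => LC.map_mono_zero I L.subtype (Submodule.subtype_injective L)
        ((hz z).trans (_root_.map_zero _).symm)
      rw [this.of_fg_ann] at hle
      exact P.2.ne_top (top_le_iff.1 hle)
    | succ j =>
      obtain ⟨δ, -, -, h5⟩ := LC.exact I (LinearMap.ker (fac n)).subtype (fac n)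
        (Submodule.subtype_injective _) hfs (LinearMap.exact_subtype_ker_map (fac n)) j
      refine hL1 j rfl (le_trans (LinearMap.annihilator_le_of_surjective δ ?_) hle)
      intro z
      exact (h5 z).1 (hz z)
  have hnot2 : ¬ Module.annihilator R L ≤ p := fun h => hnot (LTwo I hI P L hLRC hLdim h)
  obtain ⟨s, hs, hsp⟩ := SetLike.not_le_iff_exists.1 hnot2
  refine minimal_of_kill P n s hsp ?_ q hq
  intro y hy
  have hyL : (p ^ (n + 1)).mkQ y ∈ L := by
    rw [LinearMap.mem_ker]
    exact (Submodule.Quotient.mk_eq_zero _).2 hy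
  have h1 := congrArg Subtype.val (Module.mem_annihilator.1 hs ⟨_, hyL⟩)
  exact (Submodule.Quotient.mk_eq_zero _).1 h1

theorem core (I : Ideal R) (hI : I ≤ maximalIdeal R) (t : ℕ) (hcd : ∀ i, t < i → Z I i R)
    [IsArtinian R (LC I t R)]
    (hrad0 : maximalIdeal R ≤ (I ⊔ Module.annihilator R (LC I t R)).radical) :
    attachedPrimes R (LC I t R) = {p ∈ minimalAssociatedPrimes R |
        ringKrullDim (R ⧸ p) = ((t : ℕ∞) : WithBot ℕ∞) ∧ (I + p).radical = maximalIdeal R} := by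
  ext p
  constructor
  · rintro ⟨hp, N, hN⟩
    let P : PrimeSpectrum R := ⟨p, hp⟩
    have hann : Module.annihilator R (LC I t R) ≤ p := by
      rw [hN]
      exact LinearMap.annihilator_le_of_surjective _ (Submodule.mkQ_surjective N)
    have hrad : maximalIdeal R ≤ (I ⊔ P.asIdeal).radical :=
      hrad0.trans (Ideal.radical_mono (sup_le_sup_left hann I))
    have hnz : ¬ Z I t (R ⧸ P.asIdeal) := by
      intro hz
      apply hp.ne_top
      rw [hN, Module.annihilator_eq_top_iff, Submodule.Quotient.subsingleton_iff, eq_top_iff]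
      intro z _
      obtain ⟨δ, h1, -, -⟩ := LC.exact I p.subtype p.mkQ (Submodule.subtype_injective _)
        (Submodule.mkQ_surjective _) (LinearMap.exact_subtype_mkQ p) t
      obtain ⟨w, rfl⟩ := (h1 z).1 (hz _)
      have h2 : p • (⊤ : Submodule R (LC I t R)) ≤ N := by
        rw [Submodule.smul_le]
        intro r hr y _
        rw [hN] at hr
        have := Module.mem_annihilator.1 hr (N.mkQ y)
        rw [← _root_.map_smul] at this
        exact (Submodule.Quotient.mk_eq_zero _).1 this
      exact h2 (im_le I t hcd p w)
    have hd1 : t ≤ dm P := by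
      by_contra hlt
      push Not at hlt
      apply hnz
      apply vanishing
      intro q hq
      rw [Ideal.annihilator_quotient] at hq
      have : P ≤ q := hq
      exact (dm_le this).trans_lt hlt
    have hd2 : dm P ≤ t := by
      by_contra hlt
      push Not at hlt
      obtain ⟨z, hz⟩ := LThree I hI (dm P) P hrad rfl
      exact hz (cd_all I t hcd (dm P) hlt _ z)
    have hd : t = dm P := le_antisymm hd1 hd2
    subst hd
    have hmin := core_minimal I hI P hcd hrad
    refine ⟨⟨?_, ?_⟩, dm_dim P, ?_⟩
    · apply Module.associatedPrimes.minimalPrimes_annihilator_subset_associatedPrimes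
      refine ⟨⟨hp, ?_⟩, ?_⟩
      · intro r hr
        have : r = 0 := by simpa using Module.mem_annihilator.1 hr (1 : R)
        rw [this]; exact p.zero_mem
      · rintro q ⟨hq, -⟩ hqp
        have : (⟨q, hq⟩ : PrimeSpectrum R) = P := hmin ⟨q, hq⟩ hqp
        exact (congrArg PrimeSpectrum.asIdeal this).ge
    · intro q hq hqp
      exact congrArg PrimeSpectrum.asIdeal (hmin ⟨q, hq.1⟩ hqp)
    · apply le_antisymm _ hrad
      rw [← (maximalIdeal.isMaximal R).isPrime.isRadical.radical]
      exact Ideal.radical_mono (sup_le hI (le_maximalIdeal hp.ne_top))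
  · rintro ⟨⟨hpa, -⟩, hdim, hrad⟩
    let P : PrimeSpectrum R := ⟨p, hpa.1⟩
    have hd : t = dm P := by
      have := dm_dim P
      rw [show P.asIdeal = p from rfl, hdim] at this
      exact_mod_cast this
    subst hd
    refine ⟨hpa.1, LinearMap.ker (LC.map I (dm P) p.mkQ), ?_⟩
    have hs := LC.surj_of_Z' I p.mkQ (Submodule.mkQ_surjective _) (dm P)
      (cd_all I (dm P) hcd _ (by omega) _)
    rw [(LinearMap.quotKerEquivOfSurjective _ hs).annihilator_eq]
    exact (LThree_ann I hI P hrad.ge).symm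

lemma att_equiv {A B : Type u} [AddCommGroup A] [Module R A] [AddCommGroup B] [Module R B]
    (e : A ≃ₗ[R] B) : attachedPrimes R A ⊆ attachedPrimes R B := by
  rintro p ⟨hp, N, rfl⟩
  refine ⟨hp, N.map e.toLinearMap, ?_⟩
  exact (Submodule.Quotient.equiv N (N.map e.toLinearMap) e rfl).annihilator_eq

end Final
end LCAux
/-- Let `(R, m)` be a Noetherian complete local ring and `I` an ideal of `R`.
If `cd(I, R) = t` and the `R`-module `H^t_I(R)` is Artinian and `I`-cofinite, then
`Att_R H^t_I(R) = { p ∈ mAss_R R : dim R/p = t and Rad(I + p) = m }`. -/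
theorem attachedPrimes_localCohomology {R : Type u} [CommRing R] [IsNoetherianRing R]
    [IsLocalRing R] [IsAdicComplete (IsLocalRing.maximalIdeal R) R] (I : Ideal R) (t : ℕ)
    (hcd : cohomologicalDim I (ModuleCat.of R R) = ((t : ℕ∞) : WithBot ℕ∞))
    (hart : IsArtinian R ((localCohomology I t).obj (ModuleCat.of R R)))
    (hcof : IsCofinite I ((localCohomology I t).obj (ModuleCat.of R R))) :
    attachedPrimes R ((localCohomology I t).obj (ModuleCat.of R R)) =
      {p ∈ minimalAssociatedPrimes R |
        ringKrullDim (R ⧸ p) = ((t : ℕ∞) : WithBot ℕ∞) ∧ (I + p).radical = IsLocalRing.maximalIdeal R} := by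
  obtain ⟨e⟩ := LCAux.compare I (M := R) t
  have hZ : ∀ i, LCAux.Z I i R ↔ ¬ Nontrivial ((localCohomology I i).obj (ModuleCat.of R R)) := by
    intro i
    obtain ⟨e⟩ := LCAux.compare I (M := R) i
    rw [not_nontrivial_iff_subsingleton, e.toEquiv.subsingleton_congr]
    exact ⟨fun h => ⟨fun a b => (h a).trans (h b).symm⟩, fun h z => Subsingleton.elim _ _⟩
  have hcd' : ∀ i, t < i → LCAux.Z I i R := by
    intro i hi
    rw [hZ]
    intro hnt
    have h1 : ((i : ℕ∞) : WithBot ℕ∞) ≤ cohomologicalDim I (ModuleCat.of R R) :=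
      le_sSup ⟨i, hnt, rfl⟩
    rw [hcd, WithBot.coe_le_coe, Nat.cast_le] at h1
    omega
  have hI : I ≤ IsLocalRing.maximalIdeal R := by
    apply IsLocalRing.le_maximalIdeal
    rintro rfl
    have hemp : {i : ℕ | Nontrivial ((localCohomology (⊤ : Ideal R) i).obj (ModuleCat.of R R))} = ∅ := by
      ext i
      simp only [Set.mem_ofPred_eq, Set.mem_empty_iff_false, iff_false]
      rw [← hZ]
      intro z
      obtain ⟨n, hn⟩ := LCAux.LC.torsion ⊤ i z
      have h1 := hn 1 (by rw [Ideal.top_pow]; trivial)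
      rwa [one_smul] at h1
    rw [cohomologicalDim, hemp, Set.image_empty, sSup_empty] at hcd
    exact absurd hcd.symm (WithBot.coe_ne_bot)
  have hart' : IsArtinian R (LCAux.LC I t R) := isArtinian_of_linearEquiv e
  have hfin := LCAux.cofinite_tors I _ (hcof.2 0)
  have hfin' : Module.Finite R (Submodule.torsionBySet R (LCAux.LC I t R) (I : Set R)) := by
    let T := Submodule.torsionBySet R ((localCohomology I t).obj (ModuleCat.of R R)) (I : Set R)
    have : (Submodule.torsionBySet R (LCAux.LC I t R) (I : Set R)) = T.map e.toLinearMap := by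
      ext y
      rw [Submodule.mem_map]
      constructor
      · intro hy
        refine ⟨e.symm y, ?_, by simp⟩
        rw [Submodule.mem_torsionBySet_iff] at hy ⊢
        intro a
        have := hy a
        rw [← map_smul, this, map_zero]
      · rintro ⟨x, hx, rfl⟩
        rw [Submodule.mem_torsionBySet_iff] at hx ⊢
        intro a
        have h1 : (a : R) • x = 0 := hx a
        change (a : R) • e x = 0
        rw [← map_smul, h1, map_zero]
    rw [this]
    infer_instance
  rw [← LCAux.core I hI t hcd' (LCAux.cofinite_step I hI hfin')]
  exact Set.Subset.antisymm (LCAux.att_equiv e) (LCAux.att_equiv e.symm)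
end

section
/- Let R be a Noetherian ring, I an ideal of R, and M, N two finitely generated R-modules. If Supp M ⊆ Supp N, then cd(I, M) ≤ cd(I, N). -/
universe u

open CategoryTheory

namespace CdAux

open Limits Opposite

noncomputable section

variable {R : Type u} [CommRing R]

section General

set_option linter.unusedSectionVars false

universe v w
variable {D : Type w} [Category.{v} D] [Abelian D] {E : D} [Injective E]

def hcls (K : ChainComplex D ℕ) (n : ℕ) (k : K.X n ⟶ E) (hk : K.d (n+1) n ≫ k = 0) :
    K.homology n ⟶ E :=
  K.homologyι n ≫ K.descOpcycles k (n+1) (by simp) hk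

lemma hcls_surjective (K : ChainComplex D ℕ) (n : ℕ) (h : K.homology n ⟶ E) :
    ∃ (k : K.X n ⟶ E) (hk : K.d (n+1) n ≫ k = 0), hcls K n k hk = h := by
  let q := Injective.factorThru h (K.homologyι n)
  have hq : K.homologyι n ≫ q = h := Injective.comp_factorThru _ _
  refine ⟨K.pOpcycles n ≫ q, by simp, ?_⟩
  have : K.descOpcycles (K.pOpcycles n ≫ q) (n+1) (by simp) (by simp) = q := by
    rw [← cancel_epi (K.pOpcycles n), HomologicalComplex.p_descOpcycles]
  rw [hcls, this, hq]

lemma hcls_eq_zero_iff (K : ChainComplex D ℕ) (n : ℕ) (k : K.X n ⟶ E)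
    (hk : K.d (n+1) n ≫ k = 0) (p : ℕ) (hp : (ComplexShape.down ℕ).next n = p) :
    hcls K n k hk = 0 ↔ ∃ g : K.X p ⟶ E, K.d n p ≫ g = k := by
  constructor
  · intro h1
    let S := ShortComplex.mk _ _ (K.homologyι_comp_fromOpcycles n p)
    have hS : S.Exact := S.exact_of_f_is_kernel (K.homologyIsKernel n p hp)
    have hk' : K.fromOpcycles n p ≫ hS.descToInjective _ h1 = _ :=
      hS.comp_descToInjective _ h1
    refine ⟨hS.descToInjective _ h1, ?_⟩
    have := congr(K.pOpcycles n ≫ $hk')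
    rw [HomologicalComplex.p_descOpcycles, HomologicalComplex.p_fromOpcycles_assoc] at this
    exact this
  · rintro ⟨g, rfl⟩
    have : K.descOpcycles (K.d n p ≫ g) (n+1) (by simp) hk = K.fromOpcycles n p ≫ g := by
      rw [← cancel_epi (K.pOpcycles n), HomologicalComplex.p_descOpcycles,
        HomologicalComplex.p_fromOpcycles_assoc]
    rw [hcls, this]
    simp

lemma map_hcls {K K' : ChainComplex D ℕ} (ψ : K' ⟶ K) (n : ℕ) (k : K.X n ⟶ E)
    (hk : K.d (n+1) n ≫ k = 0) :
    HomologicalComplex.homologyMap ψ n ≫ hcls K n k hk =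
      hcls K' n (ψ.f n ≫ k) (by simp [← ψ.comm_assoc, hk]) := by
  rw [hcls, hcls, HomologicalComplex.homologyι_naturality_assoc]
  congr 1
  rw [← cancel_epi (HomologicalComplex.pOpcycles _ _), HomologicalComplex.p_opcyclesMap_assoc,
    HomologicalComplex.p_descOpcycles, HomologicalComplex.p_descOpcycles]

end General

/-- The contravariant hom functor into `Y`, as a covariant functor to the opposite category. -/
abbrev homF (Y : ModuleCat.{u} R) : ModuleCat.{u} R ⥤ (ModuleCat.{u} R)ᵒᵖ :=
  ((linearYoneda R (ModuleCat.{u} R)).obj Y).rightOp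

abbrev homK {X : ModuleCat.{u} R} (P : ProjectiveResolution X) (Y : ModuleCat.{u} R) :
    ChainComplex (ModuleCat.{u} R)ᵒᵖ ℕ :=
  ((homF Y).mapHomologicalComplex _).obj P.complex

/-- the map corresponding to an element of a module -/
def elMap (Z : ModuleCat.{u} R) (f : Z) : op Z ⟶ op (ModuleCat.of R R) :=
  Quiver.Hom.op (ModuleCat.ofHom (LinearMap.toSpanSingleton R Z f))

lemma elMap_comp {Z Z' : ModuleCat.{u} R} (g : Z ⟶ Z') (f : Z) :
    g.op ≫ elMap Z f = elMap Z' (g.hom f) := by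
  apply Quiver.Hom.unop_inj
  refine ModuleCat.hom_ext (LinearMap.ext_ring ?_)
  change g.hom ((1 : R) • f) = (1 : R) • _
  rw [one_smul, one_smul]

lemma elMap_zero {Z : ModuleCat.{u} R} : elMap Z 0 = 0 := by
  apply Quiver.Hom.unop_inj
  refine ModuleCat.hom_ext (LinearMap.ext_ring ?_)
  change (1 : R) • (0 : Z) = 0
  rw [smul_zero]

lemma elMap_injective {Z : ModuleCat.{u} R} : Function.Injective (elMap Z) := by
  intro f g h
  have h2 : (1 : R) • f = (1 : R) • g := congr(($h).unop.hom (1 : R))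
  rwa [one_smul, one_smul] at h2

lemma elMap_surjective {Z : ModuleCat.{u} R} : Function.Surjective (elMap Z) := by
  intro k
  refine ⟨k.unop.hom (1 : R), ?_⟩
  apply Quiver.Hom.unop_inj
  refine ModuleCat.hom_ext (LinearMap.ext_ring ?_)
  exact one_smul R (k.unop.hom (1 : R))

/-- the map corresponding to an element of a hom module -/
def ptMap {Z Y : ModuleCat.{u} R} (f : Z ⟶ Y) : (homF Y).obj Z ⟶ op (ModuleCat.of R R) :=
  elMap (ModuleCat.of R (Z ⟶ Y)) f

lemma map_ptMap {Z Z' Y : ModuleCat.{u} R} (g : Z' ⟶ Z) (f : Z ⟶ Y) :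
    (homF Y).map g ≫ ptMap f = ptMap (g ≫ f) :=
  elMap_comp (((linearYoneda R (ModuleCat.{u} R)).obj Y).map g.op) f

lemma ptMap_zero {Z Y : ModuleCat.{u} R} : ptMap (0 : Z ⟶ Y) = 0 := elMap_zero

lemma ptMap_injective {Z Y : ModuleCat.{u} R} : Function.Injective (ptMap (Z := Z) (Y := Y)) :=
  fun _ _ h => elMap_injective (Z := ModuleCat.of R (Z ⟶ Y)) h

lemma ptMap_surjective {Z Y : ModuleCat.{u} R} (k : (homF Y).obj Z ⟶ op (ModuleCat.of R R)) :
    ∃ f, ptMap f = k := elMap_surjective (Z := ModuleCat.of R (Z ⟶ Y)) k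

variable {X Y : ModuleCat.{u} R} (P : ProjectiveResolution X)

/-- `ptMap` as a map out of a term of the hom complex -/
def cMap {n : ℕ} (f : P.complex.X n ⟶ Y) : (homK P Y).X n ⟶ op (ModuleCat.of R R) := ptMap f

lemma d_cMap {m n : ℕ} (f : P.complex.X n ⟶ Y) :
    (homK P Y).d m n ≫ cMap P f = cMap P (P.complex.d m n ≫ f) :=
  map_ptMap _ _

lemma cMap_zero {n : ℕ} : cMap P (0 : P.complex.X n ⟶ Y) = 0 := ptMap_zero

lemma cMap_injective {n : ℕ} : Function.Injective (cMap (n := n) (Y := Y) P) := ptMap_injective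

lemma cMap_surjective {n : ℕ} : Function.Surjective (cMap (n := n) (Y := Y) P) := ptMap_surjective

lemma cocycle_aux {n : ℕ} (f : P.complex.X n ⟶ Y) (hf : P.complex.d (n+1) n ≫ f = 0) :
    (homK P Y).d (n+1) n ≫ cMap P f = 0 := by
  rw [d_cMap, hf, cMap_zero]

/-- comparison iso -/
def dIso (Y : ModuleCat.{u} R) (n : ℕ) :
    ((homF Y).leftDerived n).obj X ≅ (homK P Y).homology n :=
  P.isoLeftDerivedObj (homF Y) n

/-- class, as a map -/
def cls {n : ℕ} (f : P.complex.X n ⟶ Y) (hf : P.complex.d (n+1) n ≫ f = 0) :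
    ((homF Y).leftDerived n).obj X ⟶ op (ModuleCat.of R R) :=
  (dIso P Y n).hom ≫ hcls (homK P Y) n (cMap P f) (cocycle_aux P f hf)

instance : Injective (op (ModuleCat.of R R)) :=
  have : Projective (ModuleCat.of R R) := by
    rw [← IsProjective.iff_projective]; infer_instance
  inferInstance

lemma cls_surjective {n : ℕ} (h : ((homF Y).leftDerived n).obj X ⟶ op (ModuleCat.of R R)) :
    ∃ (f : P.complex.X n ⟶ Y) (hf : P.complex.d (n+1) n ≫ f = 0), cls P f hf = h := by
  obtain ⟨k, hk, e⟩ := hcls_surjective (homK P Y) n ((dIso P Y n).inv ≫ h)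
  obtain ⟨f, rfl⟩ := cMap_surjective P k
  refine ⟨f, cMap_injective P ?_, ?_⟩
  · rw [← d_cMap, hk, cMap_zero]
  · rw [cls, e, Iso.hom_inv_id_assoc]

lemma cls_eq_zero_iff_aux {n : ℕ} (f : P.complex.X n ⟶ Y) (hf : P.complex.d (n+1) n ≫ f = 0)
    (p : ℕ) (hp : (ComplexShape.down ℕ).next n = p) :
    cls P f hf = 0 ↔ ∃ g : P.complex.X p ⟶ Y, P.complex.d n p ≫ g = f := by
  have h1 : cls P f hf = 0 ↔ hcls (homK P Y) n (cMap P f) (cocycle_aux P f hf) = 0 := by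
    rw [← cancel_epi (dIso P Y n).hom, comp_zero, cls]
  rw [h1, hcls_eq_zero_iff _ _ _ _ p hp]
  constructor
  · rintro ⟨k, hk⟩
    obtain ⟨g, rfl⟩ := cMap_surjective P k
    exact ⟨g, cMap_injective P (by rw [← d_cMap, hk])⟩
  · rintro ⟨g, rfl⟩
    exact ⟨cMap P g, d_cMap _ _⟩

lemma dIso_naturality {X' : ModuleCat.{u} R} (P' : ProjectiveResolution X') {g : X' ⟶ X}
    (φ : ProjectiveResolution.Hom P' P g) (n : ℕ) :
    ((homF Y).leftDerived n).map g ≫ (dIso P Y n).hom = (dIso P' Y n).hom ≫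
      HomologicalComplex.homologyMap (((homF Y).mapHomologicalComplex _).map φ.hom) n :=
  ProjectiveResolution.isoLeftDerivedObj_hom_naturality g P' P φ.hom
    (by simpa using φ.hom_f_zero_comp_π_f_zero) _ _

lemma map_cls {X' : ModuleCat.{u} R} (P' : ProjectiveResolution X') {g : X' ⟶ X}
    (φ : ProjectiveResolution.Hom P' P g)
    {n : ℕ} (f : P.complex.X n ⟶ Y) (hf : P.complex.d (n+1) n ≫ f = 0) :
    ((homF Y).leftDerived n).map g ≫ cls P f hf =
      cls P' (φ.hom.f n ≫ f) (by simp [← φ.hom.comm_assoc, hf]) := by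
  rw [cls, ← Category.assoc, dIso_naturality P P' φ, cls, Category.assoc, map_hcls]
  have : (((homF Y).mapHomologicalComplex _).map φ.hom).f n ≫ cMap P f =
    cMap P' (φ.hom.f n ≫ f) := map_ptMap _ _
  congr 2

open Abelian in
lemma extMk_eq_zero_iff_aux {n : ℕ} (f : P.complex.X n ⟶ Y) (hf : P.complex.d (n+1) n ≫ f = 0) :
    P.extMk f (n+1) rfl hf = 0 ↔ cls P f hf = 0 := by
  rcases n with _ | n
  · rw [cls_eq_zero_iff_aux P f hf 0 (by simp)]
    simp only [← P.extEquivCohomologyClass.apply_eq_iff_eq,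
      ProjectiveResolution.extEquivCohomologyClass_extMk,
      ProjectiveResolution.extEquivCohomologyClass_zero,
      CochainComplex.HomComplex.CohomologyClass.mk_eq_zero_iff]
    rw [CochainComplex.HomComplex.Cocycle.toSingleMk_mem_coboundaries_iff _ _ _ _ _ 1 (by simp)]
    have hz : IsZero (P.cochainComplex.X 1) := by
      exact P.cochainComplex.isZero_of_isStrictlyLE 0 1 (by simp)
    constructor
    · rintro ⟨g, hg⟩
      rw [hz.eq_of_src g 0, comp_zero] at hg
      refine ⟨0, ?_⟩
      rw [← cancel_epi (P.cochainComplexXIso (-((0:ℕ):ℤ)) 0 rfl).hom]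
      simpa using hg
    · rintro ⟨g, hg⟩
      refine ⟨0, ?_⟩
      have : f = 0 := by rw [← hg]; simp
      rw [this]; simp
  · rw [cls_eq_zero_iff_aux P f hf n (by simp), P.extMk_eq_zero_iff f _ rfl hf n rfl]


/-- `R ⧸ I ^ n` as an object -/
abbrev Q (I : Ideal R) (n : ℕ) : ModuleCat.{u} R := ModuleCat.of R (R ⧸ I ^ n)

/-- the transition map -/
abbrev tr (I : Ideal R) {n m : ℕ} (h : n ≤ m) : Q I m ⟶ Q I n :=
  ModuleCat.ofHom (Submodule.mapQ _ _ LinearMap.id (Ideal.pow_le_pow_right h))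

/-- Elementary form of the vanishing of local cohomology. -/
def Van (I : Ideal R) (i : ℕ) (M : ModuleCat.{u} R) : Prop :=
  ∀ (n : ℕ) (ξ : Abelian.Ext (Q I n) M i), ∃ (m : ℕ) (h : n ≤ m),
    (Abelian.Ext.mk₀ (tr I h)).comp ξ (zero_add i) = 0

lemma old_ext_iff {X X' : ModuleCat.{u} R} (g : X' ⟶ X) (M : ModuleCat.{u} R) (i : ℕ)
    (P : ProjectiveResolution X) (P' : ProjectiveResolution X') (f : P.complex.X i ⟶ M)
    (hf : P.complex.d (i+1) i ≫ f = 0) :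
    (Abelian.Ext.mk₀ g).comp (P.extMk f (i+1) rfl hf) (zero_add i) = 0 ↔
      ((homF M).leftDerived i).map g ≫ cls P f hf = 0 := by
  let φ : ProjectiveResolution.Hom P' P g :=
    { hom := ProjectiveResolution.lift g P' P
      hom_f_zero_comp_π_f_zero := by
        have := congr(HomologicalComplex.Hom.f $(ProjectiveResolution.lift_commutes g P' P) 0)
        exact this }
  rw [ProjectiveResolution.mk₀_comp_extMk f _ rfl hf φ, map_cls P P' φ, extMk_eq_zero_iff_aux]

lemma cls_elMap (X M : ModuleCat.{u} R) (i : ℕ)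
    (x : (((Ext R (ModuleCat.{u} R) i).obj (op X)).obj M)) :
    ∃ (P : ProjectiveResolution X) (f : P.complex.X i ⟶ M) (hf : P.complex.d (i+1) i ≫ f = 0),
      cls P f hf = elMap (((Ext R (ModuleCat.{u} R) i).obj (op X)).obj M) x := by
  let P := projectiveResolution X
  obtain ⟨f, hf, e⟩ := cls_surjective P (Y := M) (n := i) (elMap _ x)
  exact ⟨P, f, hf, e⟩

lemma forall_ext_iff (M : ModuleCat.{u} R) (i : ℕ) (X : ModuleCat.{u} R) {ι : Type*}
    (X' : ι → ModuleCat.{u} R) (g : ∀ j, X' j ⟶ X) :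
    (∀ ξ : Abelian.Ext X M i, ∃ j, (Abelian.Ext.mk₀ (g j)).comp ξ (zero_add i) = 0) ↔
    (∀ x : (((Ext R (ModuleCat.{u} R) i).obj (op X)).obj M), ∃ j,
      (((Ext R (ModuleCat.{u} R) i).map (g j).op).app M).hom x = 0) := by
  have key (P : ProjectiveResolution X) (f : P.complex.X i ⟶ M)
      (hf : P.complex.d (i+1) i ≫ f = 0)
      (x : (((Ext R (ModuleCat.{u} R) i).obj (op X)).obj M))
      (h : cls P f hf = elMap (((Ext R (ModuleCat.{u} R) i).obj (op X)).obj M) x) (j : ι) :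
      (Abelian.Ext.mk₀ (g j)).comp (P.extMk f (i+1) rfl hf) (zero_add i) = 0 ↔
      (((Ext R (ModuleCat.{u} R) i).map (g j).op).app M).hom x = 0 := by
    rw [old_ext_iff (g j) M i P (projectiveResolution (X' j)) f hf, h]
    have h2 := elMap_comp (((Ext R (ModuleCat.{u} R) i).map (g j).op).app M) x
    constructor
    · intro h3
      apply elMap_injective
      rw [elMap_zero]
      exact h2.symm.trans h3
    · intro h3
      rw [h3, elMap_zero] at h2
      exact h2
  constructor
  · intro H x
    obtain ⟨P, f, hf, h⟩ := cls_elMap X M i x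
    obtain ⟨j, hj⟩ := H (P.extMk f (i+1) rfl hf)
    exact ⟨j, (key P f hf x h j).1 hj⟩
  · intro H ξ
    let P := projectiveResolution X
    obtain ⟨f, hf, rfl⟩ := P.extMk_surjective ξ (i+1) rfl
    obtain ⟨x, hx⟩ := elMap_surjective
      (Z := ((Ext R (ModuleCat.{u} R) i).obj (op X)).obj M) (cls P f hf)
    obtain ⟨j, hj⟩ := H x
    exact ⟨j, (key P f hf x hx.symm j).2 hj⟩

lemma subsingleton_colimit_iff (F : ℕᵒᵖᵒᵖ ⥤ ModuleCat.{u} R) :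
    Subsingleton (colimit F : ModuleCat.{u} R) ↔
      ∀ (n : ℕ) (x : F.obj (op (op n))), ∃ j : {m : ℕ // n ≤ m},
        (F.map (homOfLE j.2).op.op).hom x = 0 := by
  have : PreservesFilteredColimitsOfSize.{0, 0} (forget (ModuleCat.{u} R)) :=
    preservesFilteredColimitsOfSize_shrink.{0, u, 0, u} _
  have : IsFiltered ℕᵒᵖᵒᵖ := inferInstance
  have : PreservesColimit F (forget (ModuleCat R)) :=
    (PreservesFilteredColimitsOfSize.preserves_filtered_colimits ℕᵒᵖᵒᵖ).preservesColimit
  constructor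
  · intro H n x
    obtain ⟨j', i, h⟩ := Concrete.colimit_rep_eq_zero R F (op (op n)) x (Subsingleton.elim _ _)
    exact ⟨⟨j'.unop.unop, leOfHom i.unop.unop⟩, h⟩
  · intro H
    refine subsingleton_of_forall_eq 0 fun y => ?_
    obtain ⟨j, x, rfl⟩ := Concrete.colimit_exists_rep F y
    obtain ⟨m, hm⟩ := H j.unop.unop x
    have := congr((ModuleCat.Hom.hom $(colimit.w F (homOfLE m.2).op.op)) x)
    refine Eq.trans this.symm ?_
    change (colimit.ι F _).hom ((F.map (homOfLE m.2).op.op).hom x) = 0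
    rw [hm, map_zero]

lemma van_iff (I : Ideal R) (i : ℕ) (M : ModuleCat.{u} R) :
    Subsingleton ((localCohomology I i).obj M) ↔ Van I i M := by
  let D := localCohomology.diagram (localCohomology.idealPowersDiagram I) i
  have e : (localCohomology I i).obj M ≅ colimit (D ⋙ (evaluation _ _).obj M) :=
    preservesColimitIso ((evaluation _ _).obj M) D
  rw [e.toLinearEquiv.toEquiv.subsingleton_congr, subsingleton_colimit_iff]
  refine forall_congr' fun n => ?_
  have := forall_ext_iff M i (Q I n) (fun j : {m : ℕ // n ≤ m} => Q I j.1) (fun j => tr I j.2)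
  simp only [Subtype.exists] at this ⊢
  exact this.symm


open Abelian (Ext)
open Abelian.Ext (mk₀)

section Mod

variable {A B C : Type u} [AddCommGroup A] [AddCommGroup B] [AddCommGroup C]
  [Module R A] [Module R B] [Module R C]

/-- short complex from an exact pair of linear maps -/
abbrev sc (f : A →ₗ[R] B) (g : B →ₗ[R] C) (h : Function.Exact f g) :
    ShortComplex (ModuleCat.{u} R) :=
  ShortComplex.mk (ModuleCat.ofHom f) (ModuleCat.ofHom g)
    (by ext x; exact h.apply_apply_eq_zero x)

lemma sc_shortExact (f : A →ₗ[R] B) (g : B →ₗ[R] C) (hf : Function.Injective f)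
    (hg : Function.Surjective g) (h : Function.Exact f g) : (sc f g h).ShortExact where
  exact := (ShortComplex.ShortExact.moduleCat_exact_iff_function_exact _).2 h
  mono_f := (ModuleCat.mono_iff_injective _).2 hf
  epi_g := (ModuleCat.epi_iff_surjective _).2 hg

lemma tr_comp (I : Ideal R) {n m k : ℕ} (h : n ≤ m) (h' : m ≤ k) :
    tr I h' ≫ tr I h = tr I (h.trans h') := by
  ext; rfl

lemma tr_tr {I : Ideal R} {n m k i : ℕ} (h : n ≤ m) (h' : m ≤ k) {M : ModuleCat.{u} R}
    (ξ : Abelian.Ext (Q I n) M i) :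
    (mk₀ (tr I h')).comp ((mk₀ (tr I h)).comp ξ (zero_add i)) (zero_add i) =
      (mk₀ (tr I (h.trans h'))).comp ξ (zero_add i) := by
  rw [Abelian.Ext.mk₀_comp_mk₀_assoc, tr_comp]

lemma van_mid {I : Ideal R} {i : ℕ} (f : A →ₗ[R] B) (g : B →ₗ[R] C) (hf : Function.Injective f)
    (hg : Function.Surjective g) (h : Function.Exact f g)
    (hA : Van I i (ModuleCat.of R A)) (hC : Van I i (ModuleCat.of R C)) :
    Van I i (ModuleCat.of R B) := by
  have hS := sc_shortExact f g hf hg h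
  intro n ξ
  obtain ⟨m, hm, e⟩ := hC n (ξ.comp (mk₀ (sc f g h).g) (add_zero i))
  rw [← Abelian.Ext.comp_assoc_of_third_deg_zero] at e
  obtain ⟨η, hη⟩ := Abelian.Ext.covariant_sequence_exact₂ _ hS _ e
  obtain ⟨k, hk, e'⟩ := hA m η
  refine ⟨k, hm.trans hk, ?_⟩
  rw [← tr_tr hm hk, ← hη, ← Abelian.Ext.comp_assoc_of_third_deg_zero, e', Abelian.Ext.zero_comp]

lemma van_right {I : Ideal R} {i : ℕ} (f : A →ₗ[R] B) (g : B →ₗ[R] C) (hf : Function.Injective f)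
    (hg : Function.Surjective g) (h : Function.Exact f g)
    (hB : Van I i (ModuleCat.of R B)) (hA : Van I (i+1) (ModuleCat.of R A)) :
    Van I i (ModuleCat.of R C) := by
  have hS := sc_shortExact f g hf hg h
  intro n ξ
  obtain ⟨m, hm, e⟩ := hA n (ξ.comp hS.extClass rfl)
  rw [← Abelian.Ext.comp_assoc _ _ _ (zero_add i) rfl (by omega)] at e
  obtain ⟨η, hη⟩ := Abelian.Ext.covariant_sequence_exact₃ _ hS _ rfl e
  obtain ⟨k, hk, e'⟩ := hB m η
  refine ⟨k, hm.trans hk, ?_⟩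
  rw [← tr_tr hm hk, ← hη, ← Abelian.Ext.comp_assoc_of_third_deg_zero, e', Abelian.Ext.zero_comp]

lemma van_left {I : Ideal R} {i : ℕ} (f : A →ₗ[R] B) (g : B →ₗ[R] C) (hf : Function.Injective f)
    (hg : Function.Surjective g) (h : Function.Exact f g)
    (hC : Van I i (ModuleCat.of R C)) (hB : Van I (i+1) (ModuleCat.of R B)) :
    Van I (i+1) (ModuleCat.of R A) := by
  have hS := sc_shortExact f g hf hg h
  intro n ξ
  obtain ⟨m, hm, e⟩ := hB n (ξ.comp (mk₀ (sc f g h).f) (add_zero _))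
  rw [← Abelian.Ext.comp_assoc_of_third_deg_zero] at e
  obtain ⟨η, hη⟩ := Abelian.Ext.covariant_sequence_exact₁ _ hS _ e rfl
  obtain ⟨k, hk, e'⟩ := hC m η
  refine ⟨k, hm.trans hk, ?_⟩
  rw [← tr_tr hm hk, ← hη, ← Abelian.Ext.comp_assoc _ _ _ (zero_add i) rfl (by omega), e',
    Abelian.Ext.zero_comp]

lemma van_of_subsingleton (I : Ideal R) (i : ℕ) [Subsingleton A] :
    Van I i (ModuleCat.of R A) := by
  intro n ξ
  refine ⟨n, le_rfl, ?_⟩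
  have : ξ = 0 := by
    rw [← ξ.comp_mk₀_id, show 𝟙 (ModuleCat.of R A) = 0 from
      (ModuleCat.isZero_of_subsingleton _).eq_of_src _ _, Abelian.Ext.mk₀_zero,
      Abelian.Ext.comp_zero]
  rw [this, Abelian.Ext.comp_zero]

lemma van_of_equiv {I : Ideal R} {i : ℕ} (e : A ≃ₗ[R] B) (hA : Van I i (ModuleCat.of R A)) :
    Van I i (ModuleCat.of R B) := by
  refine van_mid e.toLinearMap (0 : B →ₗ[R] PUnit.{u+1}) e.injective
    (fun x => ⟨0, Subsingleton.elim _ _⟩) ?_ hA (van_of_subsingleton I i)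
  intro b
  simp only [LinearMap.zero_apply, true_iff]
  exact e.surjective b

lemma van_of_bijective {I : Ideal R} (i : ℕ) {x : R} (hx : x ∈ I)
    (h : Function.Bijective (fun a : A => x • a)) : Van I i (ModuleCat.of R A) := by
  intro n ξ
  refine ⟨n, le_rfl, ?_⟩
  have hbij : Function.Bijective (fun a : A => x ^ n • a) := by
    have := h.iterate n
    convert this using 1
    rw [smul_iterate]
  have h1 : x ^ n • ξ = 0 := by
    rw [← ξ.mk₀_id_comp, ← Abelian.Ext.smul_comp, ← Abelian.Ext.mk₀_smul]
    have : x ^ n • 𝟙 (Q I n) = 0 := by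
      ext
      change x ^ n • (Ideal.Quotient.mk (I ^ n) 1) = 0
      change Ideal.Quotient.mk (I ^ n) (x ^ n * 1) = 0
      rw [mul_one, Ideal.Quotient.eq_zero_iff_mem]
      exact Ideal.pow_mem_pow hx n
    rw [this, Abelian.Ext.mk₀_zero, Abelian.Ext.zero_comp]
  have hiso : IsIso (x ^ n • 𝟙 (ModuleCat.of R A)) := by
    rw [ConcreteCategory.isIso_iff_bijective]
    exact hbij
  have : ξ = 0 := by
    rw [Abelian.Ext.smul_eq_comp_mk₀] at h1
    rw [← ξ.comp_mk₀_id, ← IsIso.hom_inv_id (x ^ n • 𝟙 (ModuleCat.of R A)),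
      ← Abelian.Ext.mk₀_comp_mk₀, ← Abelian.Ext.comp_assoc_of_third_deg_zero, h1,
      Abelian.Ext.zero_comp]
  rw [this, Abelian.Ext.comp_zero]

end Mod


section Tors

variable [IsNoetherianRing R]

/-- conclusion of the induction below -/
def Kill (I : Ideal R) (M : ModuleCat.{u} R) (j : ℕ) : Prop :=
  ∀ (A : Type u) [AddCommGroup A] [Module R A] [Module.Finite R A]
    (ξ : Abelian.Ext (ModuleCat.of R A) M j), ∃ m : ℕ,
    (mk₀ (ModuleCat.ofHom (I ^ m • ⊤ : Submodule R A).subtype)).comp ξ (zero_add j) = 0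

lemma kill_step {I : Ideal R} {M : ModuleCat.{u} R} {j : ℕ} (IH : Kill I M j)
    {F A : Type u} [AddCommGroup F] [AddCommGroup A] [Module R F] [Module R A]
    [Module.Finite R F] [Module.Projective R F] (g : F →ₗ[R] A) (hg : Function.Surjective g)
    (ξ : Abelian.Ext (ModuleCat.of R A) M (j+1)) :
    ∃ m : ℕ, ∀ (F' A' : Type u) [AddCommGroup F'] [AddCommGroup A'] [Module R F'] [Module R A']
      (g' : F' →ₗ[R] A') (_ : Function.Surjective g') (φ : F' →ₗ[R] F) (ψ : A' →ₗ[R] A)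
      (_ : ψ ∘ₗ g' = g ∘ₗ φ) (_ : ∀ x, g' x = 0 → φ x ∈ I ^ m • LinearMap.ker g),
      (mk₀ (ModuleCat.ofHom ψ)).comp ξ (zero_add _) = 0 := by
  have hE := LinearMap.exact_subtype_ker_map g
  have hS := sc_shortExact _ g (Submodule.subtype_injective _) hg hE
  have : Projective (ModuleCat.of R F) := (IsProjective.iff_projective (R := R) F).1 inferInstance
  obtain ⟨η, hη⟩ := Abelian.Ext.contravariant_sequence_exact₃ hS _ ξ
    (Abelian.Ext.eq_zero_of_projective _) (add_comm 1 j)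
  obtain ⟨m, hm⟩ := IH (LinearMap.ker g) η
  refine ⟨m, ?_⟩
  intro F' A' _ _ _ _ g' hg' φ ψ hψ hφ
  have hE' := LinearMap.exact_subtype_ker_map g'
  have hS' := sc_shortExact _ g' (Submodule.subtype_injective _) hg' hE'
  have hmap : Submodule.map (LinearMap.ker g).subtype (I ^ m • ⊤) = I ^ m • LinearMap.ker g := by
    rw [Submodule.map_smul'', Submodule.map_top, Submodule.range_subtype]
  have hle : ∀ x : LinearMap.ker g', φ x ∈ LinearMap.ker g := fun x =>
    Submodule.smul_le_right (hφ x x.2)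
  let κ : LinearMap.ker g' →ₗ[R] LinearMap.ker g :=
    (φ ∘ₗ (LinearMap.ker g').subtype).codRestrict _ hle
  have hκ : ∀ x, κ x ∈ (I ^ m • ⊤ : Submodule R (LinearMap.ker g)) := by
    intro x
    have h1 := hφ x x.2
    rw [← hmap] at h1
    obtain ⟨y, hy, e⟩ := h1
    have : κ x = y := Subtype.ext e.symm
    rw [this]; exact hy
  let κ' := κ.codRestrict _ hκ
  let Φ : sc _ g' hE' ⟶ sc _ g hE :=
    { τ₁ := ModuleCat.ofHom κ
      τ₂ := ModuleCat.ofHom φ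
      τ₃ := ModuleCat.ofHom ψ
      comm₁₂ := by ext x; rfl
      comm₂₃ := by ext x; exact (LinearMap.congr_fun hψ x).symm }
  have nat := ShortComplex.ShortExact.extClass_naturality hS' hS Φ
  have hk : (mk₀ Φ.τ₁).comp η (zero_add j) = 0 := by
    have : Φ.τ₁ = ModuleCat.ofHom κ' ≫ ModuleCat.ofHom (Submodule.subtype _) := rfl
    rw [this, ← Abelian.Ext.mk₀_comp_mk₀_assoc, hm, Abelian.Ext.comp_zero]
  change (mk₀ Φ.τ₃).comp ξ (zero_add _) = 0
  rw [← hη, ← Abelian.Ext.comp_assoc _ _ _ (zero_add 1) (add_comm 1 j) (by omega), ← nat,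
    Abelian.Ext.comp_assoc _ _ _ (add_zero 1) (zero_add j) (by omega), hk, Abelian.Ext.comp_zero]

/-- every element is killed by a power of `I` -/
def IsTors (I : Ideal R) (M : Type u) [AddCommGroup M] [Module R M] : Prop :=
  ∀ m : M, I ≤ (Ideal.torsionOf R M m).radical

lemma IsTors.exists_pow {I : Ideal R} {M : Type u} [AddCommGroup M] [Module R M]
    (h : IsTors I M) (P : Submodule R M) (hP : P.FG) : ∃ n : ℕ, I ^ n • P = ⊥ := by
  induction P, hP using Submodule.fg_induction with
  | singleton x =>
    obtain ⟨n, hn⟩ := Ideal.exists_pow_le_of_le_radical_of_fg (h x) (IsNoetherian.noetherian I)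
    refine ⟨n, ?_⟩
    rw [eq_bot_iff, Submodule.smul_le]
    intro r hr y hy
    obtain ⟨a, rfl⟩ := Submodule.mem_span_singleton.1 hy
    have := hn hr
    rw [Ideal.mem_torsionOf_iff] at this
    rw [smul_comm, this, smul_zero]; exact Submodule.zero_mem _
  | sup P₁ P₂ h₁ h₂ h1 h2 =>
    obtain ⟨n, hn⟩ := h1
    obtain ⟨m, hm⟩ := h2
    refine ⟨n + m, ?_⟩
    rw [eq_bot_iff, Submodule.smul_sup, sup_le_iff, ← hn]
    constructor
    · exact Submodule.smul_mono_left (Ideal.pow_le_pow_right (by omega))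
    · rw [hn, ← hm]
      exact Submodule.smul_mono_left (Ideal.pow_le_pow_right (by omega))

lemma kill_all {I : Ideal R} {M : ModuleCat.{u} R} (hM : IsTors I M) (j : ℕ) : Kill I M j := by
  induction j with
  | zero =>
    intro A _ _ _ ξ
    obtain ⟨f, rfl⟩ := (Abelian.Ext.mk₀_bijective _ _).2 ξ
    obtain ⟨n, hn⟩ := hM.exists_pow (LinearMap.range f.hom)
      (by rw [LinearMap.range_eq_map]; exact (Module.Finite.fg_top (R := R) (M := A)).map _)
    refine ⟨n, ?_⟩
    rw [Abelian.Ext.mk₀_comp_mk₀]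
    have : ModuleCat.ofHom (I ^ n • ⊤ : Submodule R A).subtype ≫ f = 0 := by
      ext x
      change f.hom x = 0
      have h1 : f.hom x ∈ Submodule.map f.hom (I ^ n • ⊤) := ⟨_, x.2, rfl⟩
      rw [Submodule.map_smul'', Submodule.map_top, hn] at h1
      exact h1
    rw [this, Abelian.Ext.mk₀_zero]
  | succ j IH =>
    intro A _ _ _ ξ
    obtain ⟨k, g, hg⟩ := Module.Finite.exists_fin' R A
    let e : (ULift.{u} (Fin k) → R) →ₗ[R] A :=
      g ∘ₗ (LinearEquiv.funCongrLeft R R Equiv.ulift.symm).toLinearMap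
    have he : Function.Surjective e := hg.comp (LinearEquiv.surjective _)
    obtain ⟨m, hm⟩ := kill_step IH e he ξ
    obtain ⟨c, hc⟩ := Ideal.exists_pow_inf_eq_pow_smul I (LinearMap.ker e)
    refine ⟨m + c, ?_⟩
    have hmap : Submodule.map e (I ^ (m + c) • ⊤) = I ^ (m + c) • ⊤ := by
      rw [Submodule.map_smul'', Submodule.map_top, LinearMap.range_eq_top.2 he]
    refine hm (I ^ (m + c) • ⊤ : Submodule R _) (I ^ (m + c) • ⊤ : Submodule R A)
      (e.restrict fun x hx => by rw [← hmap]; exact ⟨x, hx, rfl⟩) ?_ (Submodule.subtype _)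
      (Submodule.subtype _) rfl ?_
    · rintro ⟨y, hy⟩
      have hy' := hy
      rw [← hmap] at hy'
      obtain ⟨x, hx, rfl⟩ := hy'
      exact ⟨⟨x, hx⟩, rfl⟩
    · rintro ⟨x, hx⟩ hx0
      have hx1 : x ∈ LinearMap.ker e := congr_arg Subtype.val hx0
      have : x ∈ I ^ (m + c) • ⊤ ⊓ LinearMap.ker e := ⟨hx, hx1⟩
      rw [hc _ (by omega), Nat.add_sub_cancel] at this
      exact Submodule.smul_mono le_rfl inf_le_right this

lemma van_of_tors {I : Ideal R} {M : Type u} [AddCommGroup M] [Module R M]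
    (hM : IsTors I M) (i : ℕ) : Van I (i+1) (ModuleCat.of R M) := by
  intro n ξ
  obtain ⟨m, hm⟩ := kill_step (kill_all (M := ModuleCat.of R M) hM i)
    (Submodule.mkQ (I ^ n)) (Submodule.mkQ_surjective _) ξ
  refine ⟨n + m, by omega, hm R (R ⧸ I ^ (n + m)) (Submodule.mkQ (I ^ (n + m)))
    (Submodule.mkQ_surjective _) LinearMap.id _ ?_ ?_⟩
  · ext; rfl
  · intro x hx
    rw [Submodule.ker_mkQ, smul_eq_mul, ← pow_add, add_comm]
    exact (Submodule.Quotient.mk_eq_zero _).1 hx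

end Tors

section Large

set_option linter.unusedSectionVars false

variable [IsNoetherianRing R]

lemma isTors_iff {J : Ideal R} {M : Type u} [AddCommGroup M] [Module R M] :
    IsTors J M ↔ ∀ m : M, ∀ a ∈ J, ∃ n : ℕ, a ^ n • m = 0 := by
  simp only [IsTors, SetLike.le_def, Ideal.mem_radical_iff, Ideal.mem_torsionOf_iff]

lemma isTors_sup {J : Ideal R} {x : R} {M : Type u} [AddCommGroup M] [Module R M]
    (h : IsTors J M) (hx : ∀ m : M, ∃ n : ℕ, x ^ n • m = 0) : IsTors (J ⊔ Ideal.span {x}) M := by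
  intro m
  refine sup_le (h m) ?_
  rw [Ideal.span_singleton_le_iff_mem, Ideal.mem_radical_iff]
  exact hx m

lemma van_large_aux (I : Ideal R) (l : List R) (hl : ∀ x ∈ l, x ∈ I) :
    ∀ (M : Type u) [AddCommGroup M] [Module R M] (J : Ideal R),
      I ≤ Ideal.span {x | x ∈ l} ⊔ J → IsTors J M →
      ∀ i, l.length < i → Van I i (ModuleCat.of R M) := by
  induction l with
  | nil =>
    intro M _ _ J hIJ hM i hi
    obtain ⟨i, rfl⟩ := Nat.exists_eq_succ_of_ne_zero (Nat.ne_of_gt hi)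
    have : I ≤ J := by simpa using hIJ
    exact van_of_tors (fun m => this.trans (hM m)) i
  | cons x l IH =>
    intro M _ _ J hIJ hM i hi
    have hxI : x ∈ I := hl x (by simp)
    have IH' := IH (fun y hy => hl y (by simp [hy]))
    let J' := J ⊔ Ideal.span {x}
    have hJ' : I ≤ Ideal.span {y | y ∈ l} ⊔ J' := by
      refine hIJ.trans ?_
      refine sup_le ?_ (le_sup_of_le_right le_sup_left)
      rw [Ideal.span_le]
      intro y hy
      simp only [List.mem_cons, Set.mem_ofPred_eq] at hy
      rcases hy with rfl | hy
      · exact (le_sup_of_le_right le_sup_right : Ideal.span {y} ≤ _)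
          (Ideal.mem_span_singleton_self y)
      · exact (le_sup_left : Ideal.span {y | y ∈ l} ≤ _) (Ideal.subset_span hy)
    let S := Submonoid.powers x
    let f := LocalizedModule.mkLinearMap S M
    have hbij : ∀ k : ℕ, Function.Bijective (fun a : LocalizedModule S M => x ^ k • a) := fun k =>
      (Module.End.isUnit_iff _).1 (IsLocalizedModule.map_units f (⟨x ^ k, k, rfl⟩ : S))
    have hsurj : ∀ y : LocalizedModule S M, ∃ (m : M) (k : ℕ), x ^ k • y = f m := by
      intro y
      obtain ⟨⟨m, ⟨_, k, rfl⟩⟩, h⟩ := IsLocalizedModule.surj S f y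
      exact ⟨m, k, h⟩
    rw [isTors_iff] at hM
    have hK : IsTors J' (LinearMap.ker f) := by
      refine isTors_sup (isTors_iff.2 ?_) ?_
      · intro m a ha
        obtain ⟨n, hn⟩ := hM m a ha
        exact ⟨n, Subtype.ext hn⟩
      · intro m
        have h0 : f m = f 0 := by rw [map_zero]; exact m.2
        obtain ⟨⟨_, k, rfl⟩, hk⟩ := IsLocalizedModule.exists_of_eq (S := S) h0
        rw [smul_zero] at hk
        exact ⟨k, Subtype.ext hk⟩
    have hC : IsTors J' (LocalizedModule S M ⧸ LinearMap.range f) := by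
      refine isTors_sup (isTors_iff.2 ?_) ?_
      · intro c a ha
        obtain ⟨y, rfl⟩ := Submodule.Quotient.mk_surjective _ c
        obtain ⟨m, k, h⟩ := hsurj y
        obtain ⟨n, hn⟩ := hM m a ha
        refine ⟨n, ?_⟩
        have : a ^ n • y = 0 := by
          apply (hbij k).1
          simp only
          rw [smul_comm, h, ← map_smul, hn, map_zero, smul_zero]
        rw [← Submodule.Quotient.mk_smul, this, Submodule.Quotient.mk_zero]
      · intro c
        obtain ⟨y, rfl⟩ := Submodule.Quotient.mk_surjective _ c
        obtain ⟨m, k, h⟩ := hsurj y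
        refine ⟨k, ?_⟩
        rw [← Submodule.Quotient.mk_smul, h, Submodule.Quotient.mk_eq_zero]
        exact ⟨m, rfl⟩
    simp only [List.length_cons] at hi
    obtain ⟨i, rfl⟩ := Nat.exists_eq_succ_of_ne_zero (show i ≠ 0 by omega)
    have vK := IH' _ J' hJ' hK (i+1) (by omega)
    have vC := IH' _ J' hJ' hC i (by omega)
    have vL : Van I (i+1) (ModuleCat.of R (LocalizedModule S M)) :=
      van_of_bijective _ hxI (by simpa using hbij 1)
    have vr : Van I (i+1) (ModuleCat.of R (LinearMap.range f)) :=
      van_left (LinearMap.range f).subtype (LinearMap.range f).mkQ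
        (Submodule.subtype_injective _) (Submodule.mkQ_surjective _)
        (LinearMap.exact_subtype_mkQ _) vC vL
    refine van_mid (LinearMap.ker f).subtype f.rangeRestrict (Submodule.subtype_injective _)
      f.surjective_rangeRestrict ?_ vK vr
    rw [LinearMap.exact_iff, LinearMap.ker_rangeRestrict, Submodule.range_subtype]

lemma exists_van_large (I : Ideal R) : ∃ r : ℕ, ∀ (M : Type u) [AddCommGroup M] [Module R M] (i),
    r < i → Van I i (ModuleCat.of R M) := by
  obtain ⟨s, hs⟩ := IsNoetherian.noetherian I
  refine ⟨s.toList.length, fun M _ _ i hi => ?_⟩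
  refine van_large_aux I s.toList ?_ M ⊥ ?_ ?_ i hi
  · intro x hx
    rw [← hs]
    exact Submodule.subset_span (by simpa using hx)
  · rw [sup_bot_eq, ← hs]
    refine Submodule.span_mono fun x hx => ?_
    simpa using hx
  · intro m; exact bot_le

end Large

section Main

variable [IsNoetherianRing R]

open scoped TensorProduct in
lemma exists_hom_ne_zero {N : Type u} [AddCommGroup N] [Module R N] [Module.Finite R N]
    (p : PrimeSpectrum R) (hp : p ∈ Module.support R N) :
    ∃ f : N →ₗ[R] (R ⧸ p.asIdeal), f ≠ 0 := by
  let K := p.asIdeal.ResidueField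
  have hn : Nontrivial (K ⊗[R] N) :=
    (Module.mem_support_iff_nontrivial_residueField_tensorProduct p).1 hp
  obtain ⟨φ, hφ⟩ := exists_ne (0 : Module.Dual K (K ⊗[R] N))
  let g : N →ₗ[R] K := (φ.restrictScalars R) ∘ₗ (TensorProduct.mk R K N 1)
  have hg : ∃ x, g x ≠ 0 := by
    by_contra! h
    apply hφ
    ext x
    have := h x
    simpa [g] using this
  obtain ⟨x, hx⟩ := hg
  obtain ⟨s, hs⟩ := Module.Finite.fg_top (R := R) (M := N)
  obtain ⟨b, hb⟩ := IsLocalization.exist_integer_multiples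
    (nonZeroDivisors (R ⧸ p.asIdeal)) s g
  obtain ⟨c, hc⟩ := Ideal.Quotient.mk_surjective (b : R ⧸ p.asIdeal)
  let ι : (R ⧸ p.asIdeal) →ₗ[R] K := (IsScalarTower.toAlgHom R (R ⧸ p.asIdeal) K).toLinearMap
  have hι : Function.Injective ι := IsFractionRing.injective (R ⧸ p.asIdeal) K
  have hcb : ∀ y : K, c • y = (b : R ⧸ p.asIdeal) • y := by
    intro y
    rw [← hc]
    exact (IsScalarTower.algebraMap_smul (R ⧸ p.asIdeal) c y).symm
  have hr : ∀ y, (c • g) y ∈ LinearMap.range ι := by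
    intro y
    have : (⊤ : Submodule R N) ≤ (LinearMap.range ι).comap (c • g) := by
      rw [← hs, Submodule.span_le]
      intro z hz
      obtain ⟨w, hw⟩ := hb z hz
      exact ⟨w, hw.trans (hcb _).symm⟩
    exact this trivial
  let e := LinearEquiv.ofInjective ι hι
  refine ⟨e.symm.toLinearMap ∘ₗ (c • g).codRestrict _ hr, fun h0 => ?_⟩
  have h1 := LinearMap.congr_fun h0 x
  simp only [LinearMap.comp_apply, LinearEquiv.coe_coe, LinearMap.zero_apply,
    LinearEquiv.map_eq_zero_iff] at h1
  have h2 : c • g x = 0 := congr_arg Subtype.val h1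
  rw [hcb, Algebra.smul_def, mul_eq_zero] at h2
  rcases h2 with h2 | h2
  · exact nonZeroDivisors.ne_zero b.2 ((map_eq_zero_iff _ hι).1 h2)
  · exact hx h2

lemma van_main {I : Ideal R} {N : Type u} [AddCommGroup N] [Module R N] [Module.Finite R N]
    {c : ℕ} (hN : ∀ j, c ≤ j → Van I j (ModuleCat.of R N)) {r : ℕ}
    (hr : ∀ (M : Type u) [AddCommGroup M] [Module R M] (i), r < i → Van I i (ModuleCat.of R M))
    (d : ℕ) : ∀ i, c ≤ i → r < i + d → ∀ (M : Type u) [AddCommGroup M] [Module R M]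
      [Module.Finite R M], Module.support R M ⊆ Module.support R N →
      Van I i (ModuleCat.of R M) := by
  induction d with
  | zero => intro i _ hi M _ _ _ _; exact hr M i hi
  | succ d IH =>
    intro i hci hid
    have IH' := IH (i+1) (by omega) (by omega)
    -- filtration argument
    have key : ∀ T : Set (PrimeSpectrum R),
        (∀ p ∈ T, Van I i (ModuleCat.of R (R ⧸ p.asIdeal))) →
        ∀ (M : Type u) [AddCommGroup M] [Module R M] [Module.Finite R M],
        Module.support R M ⊆ T → Van I i (ModuleCat.of R M) := by
      intro T hT M _ _ hM
      refine IsNoetherianRing.induction_on_isQuotientEquivQuotientPrime R hM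
        (motive := fun M _ _ _ => Module.support R M ⊆ T → Van I i (ModuleCat.of R M)) ?_ ?_ ?_
      · intro M _ _ _ _ _
        exact van_of_subsingleton I i
      · intro M _ _ _ p e hs
        refine van_of_equiv e.symm (hT p (hs ?_))
        rw [e.support_eq, Module.support_of_algebra]
        simp
      · intro A _ _ _ B _ _ _ C _ _ _ f g hf hg h hA hC hs
        rw [Module.support_of_exact h hf hg, Set.union_subset_iff] at hs
        exact van_mid f g hf hg h (hA hs.1) (hC hs.2)
    refine key _ fun p hp => ?_
    have wf : WellFoundedGT (PrimeSpectrum R) :=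
      StrictMono.wellFoundedGT (f := PrimeSpectrum.asIdeal) (fun _ _ h => h)
    induction p using WellFoundedGT.induction with
    | ind p IHp =>
    obtain ⟨f, hf⟩ := exists_hom_ne_zero p hp
    have vim : Van I i (ModuleCat.of R (LinearMap.range f)) := by
      refine van_right (LinearMap.ker f).subtype f.rangeRestrict (Submodule.subtype_injective _)
        f.surjective_rangeRestrict ?_ (hN i hci) (IH' _ ?_)
      · rw [LinearMap.exact_iff, LinearMap.ker_rangeRestrict, Submodule.range_subtype]
      · exact Module.support_subset_of_injective _ (Submodule.subtype_injective _)
    refine van_mid (LinearMap.range f).subtype (LinearMap.range f).mkQ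
      (Submodule.subtype_injective _) (Submodule.mkQ_surjective _)
      (LinearMap.exact_subtype_mkQ _) vim ?_
    refine key {q | p < q} (fun q hq => IHp q hq (Module.mem_support_mono hq.le hp)) _ ?_
    intro q hq
    have hq1 : p ≤ q := by
      have := Module.support_subset_of_surjective _ (Submodule.mkQ_surjective (LinearMap.range f)) hq
      rw [Module.support_of_algebra] at this
      simpa using this
    refine lt_of_le_of_ne hq1 ?_
    rintro rfl
    have hann := Module.annihilator_le_of_mem_support hq
    obtain ⟨x, hx⟩ : ∃ x, f x ≠ 0 := by
      by_contra! h
      exact hf (LinearMap.ext h)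
    obtain ⟨a, ha⟩ := Ideal.Quotient.mk_surjective (f x)
    have ha' : a ∈ Module.annihilator R ((R ⧸ p.asIdeal) ⧸ LinearMap.range f) := by
      rw [Module.mem_annihilator]
      intro z
      obtain ⟨y, rfl⟩ := Submodule.Quotient.mk_surjective _ z
      obtain ⟨t, rfl⟩ := Ideal.Quotient.mk_surjective y
      rw [← Submodule.Quotient.mk_smul, Submodule.Quotient.mk_eq_zero]
      refine ⟨t • x, ?_⟩
      rw [map_smul, ← ha, Algebra.smul_def, Algebra.smul_def, mul_comm]
      rfl
    exact hx (ha ▸ Ideal.Quotient.eq_zero_iff_mem.2 (hann ha'))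

end Main

end

end CdAux

/-- Let `R` be a Noetherian ring, `I` an ideal of `R`, and `M`, `N` two
finitely generated `R`-modules.  If `Supp M ⊆ Supp N`, then `cd(I, M) ≤ cd(I, N)`. -/
theorem cohomologicalDim_le_of_support_subset {R : Type u} [CommRing R] [IsNoetherianRing R]
    (I : Ideal R) (M N : ModuleCat.{u} R) (hM : Module.Finite R M) (hN : Module.Finite R N)
    (h : Module.support R M ⊆ Module.support R N) :
    cohomologicalDim I M ≤ cohomologicalDim I N := by
  refine sSup_le ?_
  rintro _ ⟨i, hi, rfl⟩
  by_contra hlt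
  rw [not_le] at hlt
  have hv : ∀ j, i ≤ j → CdAux.Van I j (ModuleCat.of R N) := by
    intro j hj
    rw [← CdAux.van_iff, ← not_nontrivial_iff_subsingleton]
    intro hn
    have h1 : ((j : ℕ∞) : WithBot ℕ∞) ≤ cohomologicalDim I N := le_sSup ⟨j, hn, rfl⟩
    have h2 : ((i : ℕ∞) : WithBot ℕ∞) ≤ ((j : ℕ∞) : WithBot ℕ∞) := by exact_mod_cast hj
    exact absurd (h2.trans h1) (not_le.2 hlt)
  obtain ⟨r, hr⟩ := CdAux.exists_van_large I
  have := CdAux.van_main hv hr (r + 1) i le_rfl (by omega) M h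
  have h3 := (CdAux.van_iff I i (ModuleCat.of R M)).2 this
  exact (not_nontrivial_iff_subsingleton.2 h3) hi
end
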